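/- arXiv:0705.2205 — 4 statements merged into one kernel-verified Lean document; each statement's English description precedes it below -/
import Mathlib

section
/- For every nondeterministic Büchi word automaton N with n ≥ 1 states there exists a deterministic Rabin word automaton D with at most 12^n·n^{2n} states and n pairs such that L(D) = L(N). -/
/-- The set of states occurring infinitely often in an infinite sequence. -/
def InfOcc {S : Type} (r : ℕ → S) : Set S :=
  {s | ∀ N : ℕ, ∃ n, N ≤ n ∧ r n = s}

/-- `r` is a run of the nondeterministic automaton with transition function `δ`
and initial state `s0` on the infinite word `w`. -/
def IsRun {A S : Type} (δ : S → A → Set S) (s0 : S) (w : ℕ → A) (r : ℕ → S) : Prop :=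
  r 0 = s0 ∧ ∀ j, r (j + 1) ∈ δ (r j) (w j)

/-- The language of a nondeterministic Büchi word automaton:
some run visits the acceptance set `acc` infinitely often. -/
def BuchiLang {A S : Type} (δ : S → A → Set S) (s0 : S) (acc : Set S) : Set (ℕ → A) :=
  {w | ∃ r, IsRun δ s0 w r ∧ (InfOcc r ∩ acc).Nonempty}

/-- The language of a nondeterministic Streett word automaton with pairs
`⟨R i, G i⟩`: some run `r` satisfies, for every `i`,
`inf(r) ∩ G i = ∅` or `inf(r) ∩ R i ≠ ∅`. -/
def StreettLang {A S : Type} {k : ℕ} (δ : S → A → Set S) (s0 : S)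
    (R G : Fin k → Set S) : Set (ℕ → A) :=
  {w | ∃ r, IsRun δ s0 w r ∧ ∀ i, InfOcc r ∩ G i = ∅ ∨ (InfOcc r ∩ R i).Nonempty}

/-- The unique run of a deterministic automaton with transition function `δ`
and initial state `s0` on the infinite word `w`. -/
def DetRun {A S : Type} (δ : S → A → S) (s0 : S) (w : ℕ → A) : ℕ → S
  | 0 => s0
  | j + 1 => δ (DetRun δ s0 w j) (w j)

/-- `F` is a partition of the state space into `k` (possibly empty) classes. -/
def IsPartition {S : Type} {k : ℕ} (F : Fin k → Set S) : Prop :=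
  (∀ i j : Fin k, i ≠ j → F i ∩ F j = ∅) ∧ (⋃ i, F i) = Set.univ

/-- A run is accepted by the parity condition `F 0, …, F (k-1)` iff the least
`i` such that `inf(r) ∩ F i ≠ ∅` is even. -/
def ParityAccept {S : Type} {k : ℕ} (F : Fin k → Set S) (r : ℕ → S) : Prop :=
  ∃ i : Fin k, Even (i : ℕ) ∧ (InfOcc r ∩ F i).Nonempty ∧
    ∀ j : Fin k, j < i → InfOcc r ∩ F j = ∅

/-- A run is accepted by the Rabin condition with pairs `⟨E i, F i⟩` iff for
some `i`, `inf(r) ∩ E i = ∅` and `inf(r) ∩ F i ≠ ∅`. -/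
def RabinAccept {S : Type} {k : ℕ} (E F : Fin k → Set S) (r : ℕ → S) : Prop :=
  ∃ i : Fin k, InfOcc r ∩ E i = ∅ ∧ (InfOcc r ∩ F i).Nonempty

open Filter in
/-- A sequence in a finite type meets a set in a recurring value iff it visits the set
infinitely often. -/
theorem infOcc_inter_nonempty_iff {T : Type} [Finite T] (r : ℕ → T) (F : Set T) :
    (InfOcc r ∩ F).Nonempty ↔ ∃ᶠ t in atTop, r t ∈ F := by
  constructor
  · rintro ⟨s, hs, hF⟩
    rw [frequently_atTop]
    intro N
    obtain ⟨t, ht, rfl⟩ := hs N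
    exact ⟨t, ht, hF⟩
  · intro h
    by_contra hne
    have hall : ∀ s : T, ∀ᶠ t in atTop, ¬ (r t = s ∧ s ∈ F) := by
      intro s
      by_contra hs
      have hs' : ∃ᶠ t in atTop, r t = s ∧ s ∈ F := hs
      refine hne ⟨s, fun N => ?_, ?_⟩
      · obtain ⟨t, ht, hrt, -⟩ := frequently_atTop.1 hs' N
        exact ⟨t, ht, hrt⟩
      · obtain ⟨t, -, hF⟩ := hs'.exists
        exact hF
    obtain ⟨t, hF, ht⟩ := (h.and_eventually (eventually_all.2 hall)).exists
    exact ht _ ⟨rfl, hF⟩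

open Filter in
/-- Kőnig's lemma for levelled graphs over a finite vertex type: if every level is inhabited and
every vertex of a level has a predecessor in the previous level, there is an infinite path. -/
theorem exists_infinite_path {S : Type} [Finite S] (X : ℕ → Set S) (Rel : ℕ → S → S → Prop)
    (hX : ∀ t, (X t).Nonempty)
    (hpred : ∀ t, ∀ y ∈ X (t + 1), ∃ x ∈ X t, Rel t x y) :
    ∃ r : ℕ → S, ∀ t, r t ∈ X t ∧ Rel t (r t) (r (t + 1)) := by
  have hfin : ∀ T, ∀ x ∈ X T, ∃ f : ℕ → S, f T = x ∧ (∀ t ≤ T, f t ∈ X t) ∧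
      ∀ t < T, Rel t (f t) (f (t + 1)) := by
    intro T
    induction T with
    | zero =>
      intro x hx
      refine ⟨fun _ => x, rfl, fun t ht => ?_, fun t ht => by omega⟩
      obtain rfl : t = 0 := by omega
      exact hx
    | succ T ih =>
      intro y hy
      obtain ⟨x, hx, hxy⟩ := hpred T y hy
      obtain ⟨f, hf, hfX, hfR⟩ := ih x hx
      refine ⟨fun t => if t ≤ T then f t else y, by simp, fun t ht => ?_, fun t ht => ?_⟩
      · by_cases h : t ≤ T
        · simpa [h] using hfX t h
        · obtain rfl : t = T + 1 := by omega
          simpa using hy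
      · by_cases h : t < T
        · have h1 : t ≤ T := h.le
          have h2 : t + 1 ≤ T := h
          simpa [h1, h2] using hfR t h
        · obtain rfl : t = T := by omega
          simpa [hf] using hxy
  have hfin' : ∀ T, ∃ f : ℕ → S, (∀ t ≤ T, f t ∈ X t) ∧ ∀ t < T, Rel t (f t) (f (t + 1)) := by
    intro T
    obtain ⟨x, hx⟩ := hX T
    obtain ⟨f, -, hf⟩ := hfin T x hx
    exact ⟨f, hf⟩
  choose f hfX hfR using hfin'
  have hlim : ∀ t, ∃ s, ∀ᶠ T in (hyperfilter ℕ : Filter ℕ), f T t = s := by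
    intro t
    by_contra hne
    push Not at hne
    have hall : ∀ s, ∀ᶠ T in (hyperfilter ℕ : Filter ℕ), ¬ f T t = s := hne
    obtain ⟨T, hT⟩ := (eventually_all.2 hall).exists
    exact hT _ rfl
  choose r hr using hlim
  have hlarge : ∀ t, ∀ᶠ T in (hyperfilter ℕ : Filter ℕ), t < T := fun t =>
    (Nat.hyperfilter_le_atTop) (eventually_gt_atTop t)
  refine ⟨r, fun t => ?_⟩
  obtain ⟨T, h1, h2, h3⟩ := ((hr t).and ((hr (t + 1)).and (hlarge t))).exists
  rw [← h1, ← h2]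
  exact ⟨hfX T t h3.le, hfR T t h3⟩

/-- Characteristic sequence of a finite set of naturals, ordered lexicographically. -/
def lexKey (A : Finset ℕ) : Lex (ℕ → Bool) := toLex fun i => decide (i ∈ A)

/-- If `A` and `B` agree up to `m` and `A` is lexicographically at most `B`, then every element of
`A` above `m` is bounded below by an element of `B` above `m`. -/
theorem exists_mem_le_of_lexKey_le {A B : Finset ℕ} (h : lexKey A ≤ lexKey B) {k x : ℕ}
    (hagree : ∀ j < k, (j ∈ A ↔ j ∈ B)) (hx : x ∈ A) (hk : k ≤ x) :
    ∃ y ∈ B, k ≤ y ∧ y ≤ x := by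
  rcases h.eq_or_lt with h | h
  · have := congrFun (congrArg ofLex h) x
    simp only [lexKey, ofLex_toLex, decide_eq_decide] at this
    exact ⟨x, this.1 hx, hk, le_rfl⟩
  · obtain ⟨i, hi, hlt⟩ := h
    have hi' : ∀ j < i, (j ∈ A ↔ j ∈ B) := fun j hj => decide_eq_decide.1 (hi j hj)
    have hlt' : decide (i ∈ A) < decide (i ∈ B) := hlt
    have hiAB : i ∉ A ∧ i ∈ B := by
      simpa [Bool.lt_iff] using hlt'
    by_cases hix : i ≤ x
    · refine ⟨i, hiAB.2, ?_, hix⟩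
      by_contra hik
      exact hiAB.1 ((hagree i (by omega)).2 hiAB.2)
    · exact ⟨x, (hi' x (by omega)).1 hx, hk, le_rfl⟩

theorem exists_best_path {A S : Type} [Finite S] (δ : S → A → Set S) (a : A)
    (P : S → Finset ℕ) (q' : S) :
    ∃ B : Finset ℕ, (B = ∅ ∨ ∃ q, q' ∈ δ q a ∧ B = P q) ∧
      ∀ q, q' ∈ δ q a → lexKey (P q) ≤ lexKey B := by
  by_cases h : ∃ q, q' ∈ δ q a
  · obtain ⟨q, hq, hmax⟩ := Set.exists_max_image {q | q' ∈ δ q a} (fun q => lexKey (P q))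
      (Set.toFinite _) h
    exact ⟨P q, Or.inr ⟨q, hq, rfl⟩, hmax⟩
  · exact ⟨∅, Or.inl rfl, fun q hq => (h ⟨q, hq⟩).elim⟩

/-- The lexicographically best path among those of the `a`-predecessors of a state. -/
noncomputable def inherit {A S : Type} [Finite S] (δ : S → A → Set S) (a : A)
    (P : S → Finset ℕ) (q : S) : Finset ℕ :=
  Classical.choose (exists_best_path δ a P q)

open Classical in
/-- Move the accepting states to a fresh child of the deepest node containing them; the fresh
child of node `v` is called `n + v`. -/
noncomputable def grow {S : Type} (n : ℕ) (acc : Set S) (M : S → Finset ℕ) (q : S) : Finset ℕ :=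
  if q ∈ acc ∧ (M q).Nonempty then insert (n + (M q).sup id) (M q) else M q

/-- A node is green when its label is nonempty and covered by the labels of its children. -/
def IsGreen {S : Type} (N : S → Finset ℕ) (v : ℕ) : Prop :=
  (∃ q, v ∈ N q) ∧ ∀ q, v ∈ N q → ∃ u ∈ N q, v < u

open Classical in
/-- Remove all descendants of green nodes. -/
noncomputable def prune {S : Type} (N : S → Finset ℕ) (q : S) : Finset ℕ :=
  (N q).filter fun u => ∀ v ∈ N q, IsGreen N v → u ≤ v

/-- The names occurring in a tree. -/
def usedNames {S : Type} [Fintype S] (R : S → Finset ℕ) : Finset ℕ :=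
  Finset.univ.biUnion R

/-- The number of elements of `U` below `v`. -/
def rankIn (U : Finset ℕ) (v : ℕ) : ℕ := (U.filter (· < v)).card

/-- Rename the nodes of a tree by their age rank. -/
def compactify {S : Type} [Fintype S] (R : S → Finset ℕ) (q : S) : Finset ℕ :=
  (R q).image (rankIn (usedNames R))

/-- A Safra tree is represented by the map `P` sending a state `q` of the nondeterministic automaton
to the set of names of the tree nodes whose label contains `q`.  Names are below `n` and ordered by
age, the root being `0`, so these sets are the root-to-node paths of the tree. -/
structure IsSafraTree {S : Type} (n : ℕ) (P : S → Finset ℕ) : Prop where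
  lt : ∀ q, ∀ v ∈ P q, v < n
  tree : ∀ q q' v u, v ∈ P q → v ∈ P q' → u < v → u ∈ P q → u ∈ P q'
  zero : ∀ q, (P q).Nonempty → 0 ∈ P q

theorem mem_usedNames {S : Type} [Fintype S] {R : S → Finset ℕ} {v : ℕ} :
    v ∈ usedNames R ↔ ∃ q, v ∈ R q := by
  simp [usedNames]

theorem rankIn_mono (U : Finset ℕ) : Monotone (rankIn U) := fun _ _ h =>
  Finset.card_le_card fun x hx => by
    simp only [Finset.mem_filter] at hx ⊢
    exact ⟨hx.1, hx.2.trans_le h⟩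

theorem rankIn_lt {U : Finset ℕ} {u v : ℕ} (hu : u ∈ U) (h : u < v) :
    rankIn U u < rankIn U v := by
  apply Finset.card_lt_card
  rw [Finset.ssubset_iff_of_subset]
  · exact ⟨u, by simp [hu, h], by simp⟩
  · intro x hx
    simp only [Finset.mem_filter] at hx ⊢
    exact ⟨hx.1, hx.2.trans h⟩

theorem rankIn_inj {U : Finset ℕ} {u v : ℕ} (hu : u ∈ U) (hv : v ∈ U)
    (h : rankIn U u = rankIn U v) : u = v := by
  rcases lt_trichotomy u v with h' | h' | h'
  · have := rankIn_lt hu h'; omega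
  · exact h'
  · have := rankIn_lt hv h'; omega

theorem lt_of_rankIn_lt {U : Finset ℕ} {u v : ℕ} (h : rankIn U u < rankIn U v) : u < v := by
  by_contra h'
  have := rankIn_mono U (not_lt.1 h')
  omega

theorem rankIn_le (U : Finset ℕ) (v : ℕ) : rankIn U v ≤ v := by
  calc rankIn U v ≤ (Finset.range v).card := Finset.card_le_card fun x hx => by
        simp only [Finset.mem_filter] at hx
        exact Finset.mem_range.2 hx.2
    _ = v := Finset.card_range v

theorem rankIn_lt_card {U : Finset ℕ} {v : ℕ} (hv : v ∈ U) : rankIn U v < U.card := by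
  apply Finset.card_lt_card
  rw [Finset.ssubset_iff_of_subset (Finset.filter_subset _ _)]
  exact ⟨v, hv, by simp⟩

/-- A name fixed by the compacting renaming has all smaller names fixed as well. -/
theorem rankIn_eq_of_le {U : Finset ℕ} {m : ℕ} (hm : rankIn U m = m) {u : ℕ} (hu : u ≤ m) :
    rankIn U u = u := by
  have hset : U.filter (· < m) = Finset.range m := by
    apply Finset.eq_of_subset_of_card_le
    · intro x hx
      simp only [Finset.mem_filter] at hx
      exact Finset.mem_range.2 hx.2
    · rw [Finset.card_range]
      exact hm.ge
  have : U.filter (· < u) = Finset.range u := by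
    ext x
    have := Finset.ext_iff.1 hset x
    simp only [Finset.mem_filter, Finset.mem_range] at this ⊢
    constructor
    · exact fun h => h.2
    · exact fun h => ⟨(this.2 (by omega)).1, h⟩
  rw [rankIn, this, Finset.card_range]

theorem inherit_spec {A S : Type} [Finite S] (δ : S → A → Set S) (a : A)
    (P : S → Finset ℕ) (q' : S) :
    (inherit δ a P q' = ∅ ∨ ∃ q, q' ∈ δ q a ∧ inherit δ a P q' = P q) ∧
      ∀ q, q' ∈ δ q a → lexKey (P q) ≤ lexKey (inherit δ a P q') :=
  Classical.choose_spec (exists_best_path δ a P q')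

theorem exists_pred_of_mem_inherit {A S : Type} [Finite S] {δ : S → A → Set S} {a : A}
    {P : S → Finset ℕ} {q' : S} {v : ℕ} (h : v ∈ inherit δ a P q') :
    ∃ q, q' ∈ δ q a ∧ inherit δ a P q' = P q := by
  rcases (inherit_spec δ a P q').1 with h' | h'
  · simp [h'] at h
  · exact h'

theorem IsSafraTree.inherit {A S : Type} [Finite S] {n : ℕ} {P : S → Finset ℕ}
    (hP : IsSafraTree n P) (δ : S → A → Set S) (a : A) : IsSafraTree n (inherit δ a P) where
  lt q v hv := by
    obtain ⟨p, -, h⟩ := exists_pred_of_mem_inherit hv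
    exact hP.lt p v (h ▸ hv)
  tree q q' v u hv hv' huv hu := by
    obtain ⟨p, -, h⟩ := exists_pred_of_mem_inherit hv
    obtain ⟨p', -, h'⟩ := exists_pred_of_mem_inherit hv'
    rw [h] at hv hu
    rw [h'] at hv' ⊢
    exact hP.tree p p' v u hv hv' huv hu
  zero q := by
    rintro ⟨v, hv⟩
    obtain ⟨p, -, h⟩ := exists_pred_of_mem_inherit hv
    rw [h] at hv ⊢
    exact hP.zero p ⟨v, hv⟩

theorem subset_grow {S : Type} (n : ℕ) (acc : Set S) (M : S → Finset ℕ) (q : S) :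
    M q ⊆ grow n acc M q := by
  unfold grow
  split_ifs
  · exact Finset.subset_insert _ _
  · exact subset_rfl

theorem mem_grow {S : Type} {n : ℕ} {acc : Set S} {M : S → Finset ℕ} {q : S} {v : ℕ} :
    v ∈ grow n acc M q ↔
      v ∈ M q ∨ (q ∈ acc ∧ (M q).Nonempty ∧ v = n + (M q).sup id) := by
  unfold grow
  split_ifs with h
  · simp only [Finset.mem_insert]; tauto
  · tauto

theorem mem_of_mem_grow_of_lt {S : Type} {n : ℕ} {acc : Set S} {M : S → Finset ℕ} {q : S} {v : ℕ}
    (h : v ∈ grow n acc M q) (hv : v < n) : v ∈ M q := by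
  rcases mem_grow.1 h with h | ⟨-, -, h⟩
  · exact h
  · omega

theorem nonempty_of_mem_grow {S : Type} {n : ℕ} {acc : Set S} {M : S → Finset ℕ} {q : S} {v : ℕ}
    (h : v ∈ grow n acc M q) : (M q).Nonempty := by
  rcases mem_grow.1 h with h | h
  exacts [⟨v, h⟩, h.2.1]

theorem mem_of_mem_grow_of_notMem {S : Type} {n : ℕ} {acc : Set S} {M : S → Finset ℕ} {q : S}
    {v : ℕ} (h : v ∈ grow n acc M q) (hq : q ∉ acc) : v ∈ M q := by
  rcases mem_grow.1 h with h | h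
  exacts [h, (hq h.1).elim]

theorem sup_id_mem {A : Finset ℕ} (h : A.Nonempty) : A.sup id ∈ A := by
  obtain ⟨x, hx, h⟩ := Finset.exists_mem_eq_sup A h id
  rw [h]; exact hx

theorem grow_tree {S : Type} {n : ℕ} (acc : Set S) {M : S → Finset ℕ} (hM : IsSafraTree n M)
    (q q' : S) (v u : ℕ) (hv : v ∈ grow n acc M q) (hv' : v ∈ grow n acc M q') (huv : u < v)
    (hu : u ∈ grow n acc M q) : u ∈ grow n acc M q' := by
  apply subset_grow
  by_cases hvn : v < n
  · exact hM.tree q q' v u (mem_of_mem_grow_of_lt hv hvn) (mem_of_mem_grow_of_lt hv' hvn) huv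
      (mem_of_mem_grow_of_lt hu (huv.trans hvn))
  · rcases mem_grow.1 hv with h | ⟨-, hne, h⟩
    · exact (hvn (hM.lt q v h)).elim
    rcases mem_grow.1 hv' with h' | ⟨-, hne', h'⟩
    · exact (hvn (hM.lt q' v h')).elim
    have heq : (M q).sup id = (M q').sup id := by omega
    have huM : u ∈ M q := by
      rcases mem_grow.1 hu with hu | ⟨-, -, hu⟩
      · exact hu
      · omega
    have hm := sup_id_mem hne
    have hm' := sup_id_mem hne'
    rw [← heq] at hm'
    have hle : u ≤ (M q).sup id := Finset.le_sup (f := id) huM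
    rcases hle.eq_or_lt with h1 | h1
    · rw [h1]; exact hm'
    · exact hM.tree q q' _ u hm hm' h1 huM

theorem mem_prune {S : Type} {N : S → Finset ℕ} {q : S} {u : ℕ} :
    u ∈ prune N q ↔ u ∈ N q ∧ ∀ v ∈ N q, IsGreen N v → u ≤ v := by
  simp [prune]

theorem mem_compactify {S : Type} [Fintype S] {R : S → Finset ℕ} {q : S} {v : ℕ} :
    v ∈ compactify R q ↔ ∃ u ∈ R q, rankIn (usedNames R) u = v := by
  simp [compactify]

/-- After pruning, every node has a state belonging to none of its children. -/
theorem prune_exists_owner {S : Type} {N : S → Finset ℕ}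
    (hN : ∀ q q' v u, v ∈ N q → v ∈ N q' → u < v → u ∈ N q → u ∈ N q')
    {q : S} {v : ℕ} (hv : v ∈ prune N q) : ∃ q', v ∈ prune N q' ∧ ∀ u ∈ prune N q', u ≤ v := by
  rw [mem_prune] at hv
  by_cases hg : IsGreen N v
  · exact ⟨q, mem_prune.2 hv, fun u hu => (mem_prune.1 hu).2 v hv.1 hg⟩
  · have : ∃ q', v ∈ N q' ∧ ∀ u ∈ N q', u ≤ v := by
      by_contra h
      push Not at h
      exact hg ⟨⟨q, hv.1⟩, h⟩
    obtain ⟨q', hq', hmax⟩ := this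
    refine ⟨q', mem_prune.2 ⟨hq', fun w hw hgw => ?_⟩, fun u hu => hmax u (mem_prune.1 hu).1⟩
    rcases (hmax w hw).eq_or_lt with h | h
    · exact h.ge
    · exact hv.2 w (hN q' q v w hq' hv.1 h hw) hgw

theorem card_usedNames_le {S : Type} [Fintype S] {R : S → Finset ℕ}
    (hR : ∀ q, ∀ v ∈ R q, ∃ q', v ∈ R q' ∧ ∀ u ∈ R q', u ≤ v) :
    (usedNames R).card ≤ Fintype.card S := by
  classical
  have hsub : usedNames R ⊆ Finset.univ.image fun q => (R q).sup id := by
    intro v hv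
    obtain ⟨q, hq⟩ := mem_usedNames.1 hv
    obtain ⟨q', h1, h2⟩ := hR q v hq
    exact Finset.mem_image.2 ⟨q', Finset.mem_univ _,
      le_antisymm (Finset.sup_le h2) (Finset.le_sup (f := id) h1)⟩
  exact (Finset.card_le_card hsub).trans Finset.card_image_le

/-- The tree obtained from an inherited tree `M` by one round of growing, pruning, renaming. -/
noncomputable def rebuild {S : Type} [Fintype S] (n : ℕ) (acc : Set S) (M : S → Finset ℕ) :
    S → Finset ℕ :=
  compactify (prune (grow n acc M))

theorem IsSafraTree.rebuild {S : Type} [Fintype S] {n : ℕ} (hcard : Fintype.card S = n)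
    (acc : Set S) {M : S → Finset ℕ} (hM : IsSafraTree n M) :
    IsSafraTree n (rebuild n acc M) where
  lt q v hv := by
    obtain ⟨u, hu, rfl⟩ := mem_compactify.1 hv
    have h1 := rankIn_lt_card (mem_usedNames.2 ⟨q, hu⟩)
    have h2 := card_usedNames_le fun q v hv => prune_exists_owner (grow_tree acc hM) (q := q) hv
    omega
  tree q q' v u hv hv' huv hu := by
    obtain ⟨x, hx, rfl⟩ := mem_compactify.1 hv
    obtain ⟨x', hx', hxx'⟩ := mem_compactify.1 hv'
    obtain ⟨y, hy, rfl⟩ := mem_compactify.1 hu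
    obtain rfl := rankIn_inj (mem_usedNames.2 ⟨q', hx'⟩) (mem_usedNames.2 ⟨q, hx⟩) hxx'
    have hyx := lt_of_rankIn_lt huv
    rw [mem_prune] at hx hx' hy
    refine mem_compactify.2 ⟨y, mem_prune.2 ⟨?_, fun w hw hg => hyx.le.trans (hx'.2 w hw hg)⟩, rfl⟩
    exact grow_tree acc hM q q' x' y hx.1 hx'.1 hyx hy.1
  zero q := by
    rintro ⟨v, hv⟩
    obtain ⟨x, hx, rfl⟩ := mem_compactify.1 hv
    have hne := nonempty_of_mem_grow (mem_prune.1 hx).1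
    exact mem_compactify.2 ⟨0, mem_prune.2 ⟨subset_grow n acc M q (hM.zero q hne),
      fun _ _ _ => Nat.zero_le _⟩, Nat.le_zero.1 (rankIn_le _ _)⟩

/-- The node `v` survives a rebuilding step under the same name. -/
def IsStable {S : Type} [Fintype S] (n : ℕ) (acc : Set S) (M : S → Finset ℕ) (v : ℕ) : Prop :=
  v ∈ usedNames (prune (grow n acc M)) ∧ rankIn (usedNames (prune (grow n acc M))) v = v

theorem IsStable.mem_prune_of_mem_rebuild {S : Type} [Fintype S] {n : ℕ} {acc : Set S}
    {M : S → Finset ℕ} {m u : ℕ} (h : IsStable n acc M m) (hu : u ≤ m) {q : S}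
    (hmem : u ∈ rebuild n acc M q) : u ∈ prune (grow n acc M) q := by
  obtain ⟨x, hx, hxu⟩ := mem_compactify.1 hmem
  have hxm : x ≤ m := by
    by_contra hlt
    have := rankIn_lt h.1 (not_le.1 hlt)
    have := h.2
    omega
  rw [rankIn_eq_of_le h.2 hxm] at hxu
  exact hxu ▸ hx

theorem IsStable.mem_rebuild {S : Type} [Fintype S] {n : ℕ} {acc : Set S}
    {M : S → Finset ℕ} {m u : ℕ} (h : IsStable n acc M m) (hu : u ≤ m) {q : S}
    (hmem : u ∈ prune (grow n acc M) q) : u ∈ rebuild n acc M q :=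
  mem_compactify.2 ⟨u, hmem, rankIn_eq_of_le h.2 hu⟩

/-- The sequence of Safra trees of the automaton along the word `w`. -/
structure IsSafraRun {A S : Type} [Fintype S] (n : ℕ) (δ : S → A → Set S) (s0 : S) (acc : Set S)
    (w : ℕ → A) (P : ℕ → S → Finset ℕ) : Prop where
  zero_mem : 0 ∈ P 0 s0
  eq_start : ∀ q, (P 0 q).Nonempty → q = s0
  step : ∀ t, P (t + 1) = rebuild n acc (inherit δ (w t) (P t))
  isSafraTree : ∀ t, IsSafraTree n (P t)

section Correctness

open Filter

/-- A node that is eventually stable and infinitely often green yields an accepting run. -/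
theorem IsSafraRun.exists_accepting_run {A S : Type} [Fintype S] {n : ℕ} {δ : S → A → Set S}
    {s0 : S} {acc : Set S} {w : ℕ → A} {P : ℕ → S → Finset ℕ}
    (h : IsSafraRun n δ s0 acc w P) {i : ℕ} (hi : i < n)
    (hstable : ∀ᶠ t in atTop, IsStable n acc (inherit δ (w t) (P t)) i)
    (hgreen : ∃ᶠ t in atTop, IsGreen (grow n acc (inherit δ (w t) (P t))) i) :
    ∃ r, IsRun δ s0 w r ∧ ∃ᶠ t in atTop, r t ∈ acc := by
  obtain ⟨t₀, ht₀⟩ := eventually_atTop.1 hstable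
  have hmem : ∀ t ≥ t₀, ∀ q, i ∈ P (t + 1) q →
      i ∈ prune (grow n acc (inherit δ (w t) (P t))) q := fun t ht q hq =>
    (ht₀ t ht).mem_prune_of_mem_rebuild le_rfl (h.step t ▸ hq)
  let X : ℕ → Set S := fun t => {q | (P t q).Nonempty ∧ (t₀ < t → i ∈ P t q)}
  have hpred : ∀ t, ∀ y ∈ X (t + 1), ∃ x ∈ X t,
      y ∈ δ x (w t) ∧ inherit δ (w t) (P t) y = P t x := by
    rintro t y ⟨⟨v, hv⟩, hy⟩
    rw [h.step] at hv
    obtain ⟨x, hx, -⟩ := mem_compactify.1 hv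
    obtain ⟨z, hz⟩ := nonempty_of_mem_grow (mem_prune.1 hx).1
    obtain ⟨p, hp, heq⟩ := exists_pred_of_mem_inherit hz
    refine ⟨p, ⟨⟨z, heq ▸ hz⟩, fun ht => ?_⟩, hp, heq⟩
    rw [← heq]
    exact mem_of_mem_grow_of_lt (mem_prune.1 (hmem t ht.le y (hy (by omega)))).1 hi
  have hX : ∀ t, (X t).Nonempty := by
    have hlate : ∀ t ≥ t₀, (X (t + 1)).Nonempty := by
      intro t ht
      obtain ⟨q, hq⟩ := mem_usedNames.1 (ht₀ t ht).1
      have hq' : i ∈ P (t + 1) q := h.step t ▸ (ht₀ t ht).mem_rebuild le_rfl hq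
      exact ⟨q, ⟨i, hq'⟩, fun _ => hq'⟩
    have hearly : ∀ k t, t + k = t₀ + 1 → (X t).Nonempty := by
      intro k
      induction k with
      | zero =>
        intro t ht
        obtain rfl : t = t₀ + 1 := ht
        exact hlate t₀ le_rfl
      | succ k ih =>
        intro t ht
        obtain ⟨y, hy⟩ := ih (t + 1) (by omega)
        obtain ⟨x, hx, -⟩ := hpred t y hy
        exact ⟨x, hx⟩
    intro t
    by_cases ht : t ≤ t₀
    · exact hearly (t₀ + 1 - t) t (by omega)
    · obtain ⟨s, rfl⟩ : ∃ s, t = s + 1 := ⟨t - 1, by omega⟩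
      exact hlate s (by omega)
  obtain ⟨r, hr⟩ := exists_infinite_path X _ hX hpred
  refine ⟨r, ⟨h.eq_start _ (hr 0).1.1, fun t => (hr t).2.1⟩, fun hacc => ?_⟩
  obtain ⟨t₁, ht₁⟩ := eventually_atTop.1 hacc
  have hgrow : ∀ t ≥ t₁, ∀ u ∈ grow n acc (inherit δ (w t) (P t)) (r (t + 1)),
      u ∈ P t (r t) := fun t ht u hu => by
    rw [← (hr t).2.2]
    exact mem_of_mem_grow_of_notMem hu (ht₁ (t + 1) (by omega))
  have himem : ∀ t ≥ t₀, i ∈ prune (grow n acc (inherit δ (w t) (P t))) (r (t + 1)) :=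
    fun t ht => hmem t ht _ ((hr (t + 1)).1.2 (by omega))
  obtain ⟨s, hs, hsg⟩ := frequently_atTop.1 hgreen (max t₀ t₁)
  have hs₀ : t₀ ≤ s := (le_max_left _ _).trans hs
  have hs₁ : t₁ ≤ s := (le_max_right _ _).trans hs
  have hle : ∀ t ≥ s + 1, ∀ u ∈ P t (r t), u ≤ i := by
    intro t ht
    induction t, ht using Nat.le_induction with
    | base =>
      intro u hu
      rw [h.step] at hu
      obtain ⟨x, hx, rfl⟩ := mem_compactify.1 hu
      exact (rankIn_le _ _).trans ((mem_prune.1 hx).2 i (mem_prune.1 (himem s hs₀)).1 hsg)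
    | succ t ht ih =>
      intro u hu
      rw [h.step] at hu
      obtain ⟨x, hx, rfl⟩ := mem_compactify.1 hu
      exact (rankIn_le _ _).trans (ih x (hgrow t (by omega) x (mem_prune.1 hx).1))
  obtain ⟨s', hs', hsg'⟩ := frequently_atTop.1 hgreen (s + 1)
  obtain ⟨u, hu, hiu⟩ := hsg'.2 _ (mem_prune.1 (himem s' (by omega))).1
  have := hle s' hs' u (hgrow s' (by omega) u hu)
  omega

/-- An accepting run yields a node that is eventually stable and infinitely often green. -/
theorem IsSafraRun.exists_stable_green {A S : Type} [Fintype S] {n : ℕ} {δ : S → A → Set S}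
    {s0 : S} {acc : Set S} {w : ℕ → A} {P : ℕ → S → Finset ℕ}
    (h : IsSafraRun n δ s0 acc w P) {r : ℕ → S} (hr : IsRun δ s0 w r)
    (hacc : ∃ᶠ t in atTop, r t ∈ acc) :
    ∃ i < n, (∀ᶠ t in atTop, IsStable n acc (inherit δ (w t) (P t)) i) ∧
      ∃ᶠ t in atTop, IsGreen (grow n acc (inherit δ (w t) (P t))) i := by
  by_contra! hno
  have hM : ∀ t, IsSafraTree n (inherit δ (w t) (P t)) := fun t =>
    (h.isSafraTree t).inherit δ (w t)
  have hlex : ∀ t, lexKey (P t (r t)) ≤ lexKey (inherit δ (w t) (P t) (r (t + 1))) := fun t =>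
    (inherit_spec δ (w t) (P t) (r (t + 1))).2 (r t) (hr.2 t)
  have hprune0 : ∀ t, 0 ∈ P t (r t) →
      0 ∈ prune (grow n acc (inherit δ (w t) (P t))) (r (t + 1)) := by
    intro t ht
    obtain ⟨y, hy, -⟩ := exists_mem_le_of_lexKey_le (k := 0) (hlex t) (by simp) ht le_rfl
    exact mem_prune.2 ⟨subset_grow _ _ _ _ ((hM t).zero _ ⟨y, hy⟩), fun _ _ _ => Nat.zero_le _⟩
  have hzero : ∀ t, 0 ∈ P t (r t) := by
    intro t
    induction t with
    | zero => rw [hr.1]; exact h.zero_mem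
    | succ t ih =>
      rw [h.step]
      exact mem_compactify.2 ⟨0, hprune0 t ih, Nat.le_zero.1 (rankIn_le _ _)⟩
  have hclaim : ∀ k, ∃ m ≥ k, ∀ᶠ t in atTop, IsStable n acc (inherit δ (w t) (P t)) m ∧
      m ∈ P t (r t) ∧ ∀ j ≤ m, (j ∈ P t (r t) ↔ j ∈ P (t + 1) (r (t + 1))) := by
    intro k
    induction k with
    | zero =>
      refine ⟨0, le_rfl, Eventually.of_forall fun t => ⟨⟨?_, Nat.le_zero.1 (rankIn_le _ _)⟩,
        hzero t, fun j hj => ?_⟩⟩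
      · exact mem_usedNames.2 ⟨_, hprune0 t (hzero t)⟩
      · obtain rfl : j = 0 := by omega
        simp [hzero]
    | succ k ih =>
      obtain ⟨m, hmk, hm⟩ := ih
      have hmn : m < n := by
        obtain ⟨t, ht⟩ := hm.exists
        exact (h.isSafraTree t).lt _ m ht.2.1
      have hng := hno m hmn (hm.mono fun t ht => ht.1)
      obtain ⟨T, hT⟩ := eventually_atTop.1 (hm.and hng)
      have hmprune : ∀ t ≥ T,
          m ∈ prune (grow n acc (inherit δ (w t) (P t))) (r (t + 1)) := fun t ht =>
        (hT t ht).1.1.mem_prune_of_mem_rebuild le_rfl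
          (h.step t ▸ (hT (t + 1) (by omega)).1.2.1)
      have hagree : ∀ t ≥ T, ∀ j < m + 1,
          (j ∈ P t (r t) ↔ j ∈ inherit δ (w t) (P t) (r (t + 1))) := by
        intro t ht j hj
        rw [(hT t ht).1.2.2 j (by omega), h.step]
        constructor
        · intro hmem
          exact mem_of_mem_grow_of_lt (mem_prune.1
            ((hT t ht).1.1.mem_prune_of_mem_rebuild (by omega) hmem)).1 (by omega)
        · intro hmem
          refine (hT t ht).1.1.mem_rebuild (by omega) (mem_prune.2 ⟨subset_grow _ _ _ _ hmem, ?_⟩)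
          intro v hv hg
          have := (mem_prune.1 (hmprune t ht)).2 v hv hg
          omega
      have hprog : ∀ t ≥ T, ∀ u ∈ grow n acc (inherit δ (w t) (P t)) (r (t + 1)), m < u →
          ∃ y ≤ u, y ∈ prune (grow n acc (inherit δ (w t) (P t))) (r (t + 1)) ∧
            m < rankIn (usedNames (prune (grow n acc (inherit δ (w t) (P t))))) y := by
        intro t ht u hu hmu
        have hex : ∃ y, y ∈ grow n acc (inherit δ (w t) (P t)) (r (t + 1)) ∧ m < y := ⟨u, hu, hmu⟩
        classical
        refine ⟨Nat.find hex, Nat.find_min' hex ⟨hu, hmu⟩,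
          mem_prune.2 ⟨(Nat.find_spec hex).1, fun v hv hg => ?_⟩, ?_⟩
        · have h1 := (mem_prune.1 (hmprune t ht)).2 v hv hg
          have h2 : m ≠ v := by
            rintro rfl
            exact (hT t ht).2 hg
          exact Nat.find_min' hex ⟨hv, by omega⟩
        · have := rankIn_lt (hT t ht).1.1.1 (Nat.find_spec hex).2
          rwa [(hT t ht).1.1.2] at this
      have hex : ∃ x, m < x ∧ ∃ t ≥ T, x ∈ P t (r t) := by
        obtain ⟨s, hs, hsacc⟩ := frequently_atTop.1 hacc (T + 1)
        obtain ⟨t, rfl⟩ : ∃ t, s = t + 1 := ⟨s - 1, by omega⟩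
        have hne := nonempty_of_mem_grow (mem_prune.1 (hmprune t (by omega))).1
        obtain ⟨y, -, hy, hmy⟩ := hprog t (by omega) _ (mem_grow.2 (Or.inr ⟨hsacc, hne, rfl⟩))
          (by omega)
        exact ⟨_, hmy, t + 1, by omega, by rw [h.step]; exact mem_compactify.2 ⟨y, hy, rfl⟩⟩
      classical
      obtain ⟨hmx, t₁, ht₁, hxt₁⟩ := Nat.find_spec hex
      have hmin : ∀ y, m < y → (∃ t ≥ T, y ∈ P t (r t)) → Nat.find hex ≤ y := fun y h1 h2 =>
        Nat.find_min' hex ⟨h1, h2⟩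
      generalize Nat.find hex = x at hmx hxt₁ hmin
      have hstay : ∀ t ≥ T, x ∈ P t (r t) →
          IsStable n acc (inherit δ (w t) (P t)) x ∧ x ∈ P (t + 1) (r (t + 1)) := by
        intro t ht hx
        obtain ⟨u, hu, hmu, hux⟩ := exists_mem_le_of_lexKey_le (hlex t) (hagree t ht) hx hmx
        obtain ⟨y, hyu, hy, hmy⟩ := hprog t ht u (subset_grow _ _ _ _ hu) hmu
        have hmem := mem_compactify.2 ⟨y, hy, rfl⟩
        have hxy := hmin _ hmy ⟨t + 1, by omega, by rw [h.step]; exact hmem⟩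
        have hyy := rankIn_le (usedNames (prune (grow n acc (inherit δ (w t) (P t))))) y
        obtain rfl : y = x := by omega
        have hrank := le_antisymm hyy hxy
        refine ⟨⟨mem_usedNames.2 ⟨_, hy⟩, hrank⟩, ?_⟩
        rw [hrank] at hmem
        rw [h.step]
        exact hmem
      have hxmem : ∀ t ≥ t₁, x ∈ P t (r t) := by
        intro t ht
        induction t, ht using Nat.le_induction with
        | base => exact hxt₁
        | succ t ht ih => exact (hstay t (by omega) ih).2
      refine ⟨x, by omega, eventually_atTop.2 ⟨t₁, fun t ht => ?_⟩⟩
      obtain ⟨hst, hx'⟩ := hstay t (by omega) (hxmem t ht)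
      refine ⟨hst, hxmem t ht, fun j hj => ?_⟩
      rcases le_or_gt j m with hjm | hjm
      · exact (hT t (by omega)).1.2.2 j hjm
      rcases hj.eq_or_lt with rfl | hjx
      · exact ⟨fun _ => hx', fun _ => hxmem t ht⟩
      · constructor
        · intro hj'
          have := hmin j hjm ⟨t, by omega, hj'⟩
          omega
        · intro hj'
          have := hmin j hjm ⟨t + 1, by omega, hj'⟩
          omega
  obtain ⟨m, hmn, hm⟩ := hclaim n
  obtain ⟨t, ht⟩ := hm.exists
  have := (h.isSafraTree t).lt _ m ht.2.1
  omega

end Correctness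

section Counting

/-- One more than the largest element of a set, or `0` for the empty set. -/
def topCode (A : Finset ℕ) : ℕ := A.sup (· + 1)

theorem topCode_le {A : Finset ℕ} {n : ℕ} (h : ∀ v ∈ A, v < n) : topCode A ≤ n :=
  Finset.sup_le h

theorem lt_topCode {A : Finset ℕ} {v : ℕ} (h : v ∈ A) : v < topCode A :=
  Finset.le_sup (f := (· + 1)) h

theorem eq_of_topCode_eq {A B : Finset ℕ} (h : topCode A = topCode B)
    (hAB : ∀ v ∈ A, v ∈ B → ∀ u < v, (u ∈ A ↔ u ∈ B)) : A = B := by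
  have key : ∀ C : Finset ℕ, C.Nonempty → ∃ v ∈ C, topCode C = v + 1 := fun C hC =>
    Finset.exists_mem_eq_sup C hC _
  rcases A.eq_empty_or_nonempty with rfl | hA
  · rcases B.eq_empty_or_nonempty with rfl | hB
    · rfl
    · obtain ⟨v, hv, -⟩ := key B hB
      have := lt_topCode hv
      rw [← h] at this
      simp [topCode] at this
  · obtain ⟨v, hv, hvA⟩ := key A hA
    rcases B.eq_empty_or_nonempty with rfl | hB
    · simp [hvA] at h
      simp [topCode] at h
    · obtain ⟨v', hv', hvB⟩ := key B hB
      obtain rfl : v = v' := by omega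
      ext u
      rcases lt_trichotomy u v with hu | rfl | hu
      · exact hAB v hv hv' u hu
      · simp [hv, hv']
      · constructor
        · intro hu'
          have := lt_topCode hu'
          omega
        · intro hu'
          have := lt_topCode hu'
          omega

open Classical in
/-- The code of the parent of a node of a tree. -/
noncomputable def parentCode {S : Type} [Fintype S] (P : S → Finset ℕ) (v : ℕ) : ℕ :=
  topCode (Finset.univ.biUnion fun q => if v ∈ P q then (P q).filter (· < v) else ∅)

theorem IsSafraTree.parentCode_eq {S : Type} [Fintype S] {n : ℕ} {P : S → Finset ℕ}
    (hP : IsSafraTree n P) {q : S} {v : ℕ} (hv : v ∈ P q) :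
    parentCode P v = topCode ((P q).filter (· < v)) := by
  unfold parentCode
  congr 1
  ext u
  simp only [Finset.mem_biUnion, Finset.mem_univ, true_and, Finset.mem_filter]
  constructor
  · rintro ⟨q', hq'⟩
    split_ifs at hq' with hv'
    · rw [Finset.mem_filter] at hq'
      exact ⟨hP.tree q' q v u hv' hv hq'.2 hq'.1, hq'.2⟩
    · simp at hq'
  · intro hu
    exact ⟨q, by simp [hv, hu]⟩

theorem IsSafraTree.parentCode_le {S : Type} [Fintype S] {n : ℕ} {P : S → Finset ℕ}
    (hP : IsSafraTree n P) (v : ℕ) : parentCode P v ≤ n := by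
  refine topCode_le fun u hu => ?_
  simp only [Finset.mem_biUnion, Finset.mem_univ, true_and] at hu
  obtain ⟨q, hq⟩ := hu
  split_ifs at hq
  · exact hP.lt q u (Finset.mem_filter.1 hq).1
  · simp at hq

/-- A Safra tree is determined by the deepest node of each state and the parent of each node. -/
theorem IsSafraTree.ext {S : Type} [Fintype S] {n : ℕ} {P P' : S → Finset ℕ}
    (hP : IsSafraTree n P) (hP' : IsSafraTree n P') (htop : ∀ q, topCode (P q) = topCode (P' q))
    (hparent : ∀ v < n, parentCode P v = parentCode P' v) : P = P' := by
  have hbelow : ∀ v q q', v ∈ P q → v ∈ P' q' →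
      (P q).filter (· < v) = (P' q').filter (· < v) := by
    intro v
    induction v using Nat.strong_induction_on with
    | _ v ih =>
      intro q q' hv hv'
      apply eq_of_topCode_eq
      · rw [← hP.parentCode_eq hv, ← hP'.parentCode_eq hv', hparent v (hP.lt q v hv)]
      · intro x hx hx' u hu
        rw [Finset.mem_filter] at hx hx'
        have := Finset.ext_iff.1 (ih x hx.2 q q' hx.1 hx'.1) u
        simp only [Finset.mem_filter, hu, hu.trans hx.2, and_true] at this ⊢
        exact this
  funext q
  refine eq_of_topCode_eq (htop q) fun v hv hv' u hu => ?_
  have := Finset.ext_iff.1 (hbelow v q q hv hv') u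
  simpa [hu] using this

/-- States of the determinized automaton: a Safra tree, and for each name a flag that is `0` if
the last step was unstable for the name, `2` if it was stable and green, and `1` otherwise. -/
def SafraState (S : Type) (n : ℕ) : Type :=
  {P : S → Finset ℕ // IsSafraTree n P} × (Fin n → Fin 3)

/-- Code of a Safra tree with flags. -/
noncomputable def SafraState.encode {S : Type} [Fintype S] {n : ℕ} (x : SafraState S n) :
    (S → Fin (n + 1)) × (Fin n → Fin (n + 1)) × (Fin n → Fin 3) :=
  (fun q => ⟨topCode (x.1.1 q), Nat.lt_succ_of_le (topCode_le (x.1.2.lt q))⟩,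
    fun v => ⟨parentCode x.1.1 v, Nat.lt_succ_of_le (x.1.2.parentCode_le v)⟩, x.2)

theorem SafraState.encode_injective {S : Type} [Fintype S] {n : ℕ} :
    Function.Injective (SafraState.encode (S := S) (n := n)) := by
  rintro ⟨⟨P, hP⟩, f⟩ ⟨⟨P', hP'⟩, f'⟩ h
  simp only [encode, Prod.mk.injEq] at h
  obtain ⟨h1, h2, rfl⟩ := h
  obtain rfl : P = P' := hP.ext hP' (fun q => congrArg Fin.val (congrFun h1 q))
    fun v hv => congrArg Fin.val (congrFun h2 ⟨v, hv⟩)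
  rfl

noncomputable instance {S : Type} [Fintype S] {n : ℕ} : Fintype (SafraState S n) := by
  classical
  exact Fintype.ofInjective _ SafraState.encode_injective

theorem SafraState.card_le {S : Type} [Fintype S] {n : ℕ} (hn : 1 ≤ n)
    (hcard : Fintype.card S = n) :
    Fintype.card (SafraState S n) ≤ 12 ^ n * n ^ (2 * n) := by
  classical
  refine (Fintype.card_le_of_injective _ SafraState.encode_injective).trans ?_
  simp only [Fintype.card_prod, Fintype.card_fun, Fintype.card_fin, hcard]
  have h1 : (n + 1) ^ n ≤ (2 * n) ^ n := Nat.pow_le_pow_left (by omega) n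
  calc (n + 1) ^ n * ((n + 1) ^ n * 3 ^ n) ≤ (2 * n) ^ n * ((2 * n) ^ n * 3 ^ n) := by gcongr
    _ = (2 * 2 * 3) ^ n * n ^ (2 * n) := by rw [two_mul n, pow_add]; simp only [mul_pow]; ring
    _ = 12 ^ n * n ^ (2 * n) := by norm_num

end Counting

open Classical in
/-- Transition function of the determinized automaton. -/
noncomputable def SafraState.next {A S : Type} [Fintype S] {n : ℕ} (hcard : Fintype.card S = n)
    (δ : S → A → Set S) (acc : Set S) (x : SafraState S n) (a : A) : SafraState S n :=
  (⟨rebuild n acc (inherit δ a x.1.1), (x.1.2.inherit δ a).rebuild hcard acc⟩,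
    fun i => if IsStable n acc (inherit δ a x.1.1) i then
      if IsGreen (grow n acc (inherit δ a x.1.1)) i then 2 else 1 else 0)

open Classical in
/-- Initial state of the determinized automaton. -/
noncomputable def SafraState.start {S : Type} {n : ℕ} (hn : 1 ≤ n) (s0 : S) : SafraState S n :=
  (⟨fun q => if q = s0 then {0} else ∅, by
    constructor
    · intro q v hv
      split_ifs at hv <;> simp at hv
      omega
    · intro q q' v u hv hv' huv hu
      split_ifs at hv <;> simp at hv
      omega
    · rintro q ⟨v, hv⟩
      split_ifs at hv ⊢ <;> simp at hv ⊢⟩, fun _ => 0)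

theorem SafraState.isSafraRun {A S : Type} [Fintype S] {n : ℕ} (hn : 1 ≤ n)
    (hcard : Fintype.card S = n) (δ : S → A → Set S) (s0 : S) (acc : Set S) (w : ℕ → A) :
    IsSafraRun n δ s0 acc w
      fun t => (DetRun (SafraState.next hcard δ acc) (SafraState.start hn s0) w t).1.1 where
  zero_mem := by simp [DetRun, start]
  eq_start q hq := by
    by_contra hne
    simp [DetRun, start, hne] at hq
  step t := rfl
  isSafraTree t :=
    (DetRun (SafraState.next hcard δ acc) (SafraState.start hn s0) w t).1.2

/-- For every nondeterministic Büchi word automaton `N` with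
`n ≥ 1` states there exists a deterministic Rabin word automaton `D` with at
most `12^n·n^{2n}` states and `n` pairs such that `L(D) = L(N)`. -/
theorem nbw_to_drw (A : Type) [Fintype A] (S : Type) [Fintype S] (n : ℕ)
    (hn : 1 ≤ n) (hcard : Fintype.card S = n)
    (δ : S → A → Set S) (s0 : S) (acc : Set S) :
    ∃ (T : Type) (instT : Fintype T) (δ' : T → A → T) (t0 : T)
      (E F : Fin n → Set T),
      @Fintype.card T instT ≤ 12 ^ n * n ^ (2 * n) ∧
      {w : ℕ → A | RabinAccept E F (DetRun δ' t0 w)} = BuchiLang δ s0 acc := by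
  refine ⟨SafraState S n, inferInstance, SafraState.next hcard δ acc, SafraState.start hn s0,
    fun i => {x | x.2 i = 0}, fun i => {x | x.2 i = 2}, SafraState.card_le hn hcard, ?_⟩
  ext w
  have hrun := SafraState.isSafraRun hn hcard δ s0 acc w
  set D := DetRun (SafraState.next hcard δ acc) (SafraState.start hn s0) w with hD
  have hflag0 : ∀ t i, (D (t + 1)).2 i = 0 ↔ ¬ IsStable n acc (inherit δ (w t) (D t).1.1) i := by
    intro t i
    simp only [hD, DetRun, SafraState.next]
    split_ifs <;> simp_all
  have hflag2 : ∀ t i, (D (t + 1)).2 i = 2 ↔ IsStable n acc (inherit δ (w t) (D t).1.1) i ∧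
      IsGreen (grow n acc (inherit δ (w t) (D t).1.1)) i := by
    intro t i
    simp only [hD, DetRun, SafraState.next]
    split_ifs <;> simp_all
  have hshift : ∀ p : ℕ → Prop, (∃ᶠ t in Filter.atTop, p t) ↔ ∃ᶠ t in Filter.atTop, p (t + 1) := by
    intro p
    conv_lhs => rw [← Filter.map_add_atTop_eq_nat 1]
    exact Filter.frequently_map
  have haccept : RabinAccept (fun i => {x | x.2 i = 0}) (fun i => {x | x.2 i = 2}) D ↔
      ∃ i < n, (∀ᶠ t in Filter.atTop, IsStable n acc (inherit δ (w t) (D t).1.1) i) ∧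
        ∃ᶠ t in Filter.atTop, IsGreen (grow n acc (inherit δ (w t) (D t).1.1)) i := by
    have hiff : ∀ i : Fin n, (InfOcc D ∩ {x | x.2 i = 0} = ∅ ∧
        (InfOcc D ∩ {x | x.2 i = 2}).Nonempty) ↔
        ((∀ᶠ t in Filter.atTop, IsStable n acc (inherit δ (w t) (D t).1.1) i) ∧
          ∃ᶠ t in Filter.atTop, IsGreen (grow n acc (inherit δ (w t) (D t).1.1)) i) := by
      intro i
      rw [← Set.not_nonempty_iff_eq_empty, infOcc_inter_nonempty_iff, infOcc_inter_nonempty_iff,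
        hshift, hshift (fun t => D t ∈ _)]
      simp only [Set.mem_ofPred_eq, hflag0, hflag2, Filter.not_frequently, not_not]
      exact ⟨fun h => ⟨h.1, h.2.mono fun t ht => ht.2⟩,
        fun h => ⟨h.1, (h.2.and_eventually h.1).mono fun t ht => ht.symm⟩⟩
    constructor
    · rintro ⟨i, hi⟩
      exact ⟨i, i.2, (hiff i).1 hi⟩
    · rintro ⟨i, hin, hi⟩
      exact ⟨⟨i, hin⟩, (hiff ⟨i, hin⟩).2 hi⟩
  simp only [Set.mem_ofPred_eq, BuchiLang, infOcc_inter_nonempty_iff]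
  rw [haccept]
  constructor
  · rintro ⟨i, hi, hstable, hgreen⟩
    exact hrun.exists_accepting_run hi hstable hgreen
  · rintro ⟨r, hr, hacc⟩
    exact hrun.exists_stable_green hr hacc
end

section
/- For every nondeterministic Streett word automaton S with n ≥ 1 states and k pairs there exists a deterministic Rabin word automaton D with at most 12^{n(k+1)}·n^n·(k+1)^{n(k+1)}·(n(k+1))^{n(k+1)} states and n(k+1) pairs such that L(D) = L(S). -/
/-! ### Streett trees

A Streett tree is stored as the family of its branches: every state carries the list of nodes
containing it, from the root downwards, and a dead state carries the empty list. -/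

namespace StreettTree

/-- A node on a branch: the index its runs are waiting for (`0` when they wait for nothing,
`j + 1` for the pair `j`), and the name of the node. -/
abbrev Entry := ℕ × ℕ

variable {A S : Type} {k : ℕ}

/-- `v` is an initial segment of some branch. -/
def IsNode (P : S → List Entry) (v : List Entry) : Prop := ∃ q, v <+: P q

/-- Some branch contains a node named `x`. -/
def Alive (P : S → List Entry) (x : ℕ) : Prop := ∃ q, ∃ e ∈ P q, e.2 = x

/-- The set `U` enlarged by the indices on `v`. -/
def usedFrom (U : Finset ℕ) (v : List Entry) : Finset ℕ := U ∪ (v.map Prod.fst).toFinset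

/-- The greatest index below `i` that is not in `U`, or `0`. -/
noncomputable def nextIdx (U : Finset ℕ) (i : ℕ) : ℕ :=
  Nat.findGreatest (· ∉ U) (i - 1)

open Classical in
/-- The branch of a successor state: the given branch is cut at the first node whose index is
rewarded (`Rp`) or violated (`Gp`), and a node with the name `y` is attached, unless there is
nothing left to wait for. -/
noncomputable def extend (k : ℕ) (Rp Gp : ℕ → Prop) (y : ℕ) :
    Finset ℕ → List Entry → List Entry
  | U, [] => if nextIdx U (k + 1) = 0 then [] else [(nextIdx U (k + 1), y)]
  | U, e :: π =>
    if Rp e.1 then [(nextIdx U e.1, y)]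
    else if Gp e.1 then [(e.1, y)]
    else e :: extend k Rp Gp y (insert e.1 U) π

/-- All runs in the nodes named `x` have index `0` in the next node of their branch. -/
def Green (P : S → List Entry) (x : ℕ) : Prop :=
  ∀ v e f, IsNode P (v ++ [e, f]) → e.2 = x → f.1 = 0

open Classical in
/-- Cut a branch after the first node whose name satisfies `p`. -/
noncomputable def cut (p : ℕ → Prop) : List Entry → List Entry
  | [] => []
  | e :: π => if p e.2 then [e] else e :: cut p π

/-- Remove all the descendants of green nodes. -/
noncomputable def prune (P : S → List Entry) : S → List Entry := fun q => cut (Green P) (P q)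

open Classical in
/-- Replace every name by its rank among the names in use. -/
noncomputable def rename (P : S → List Entry) : S → List Entry :=
  fun q => (P q).map fun e => (e.1, Nat.count (Alive P) e.2)

/-- The name `x` is unstable: it or a smaller name is not in use. -/
def Bad (P : S → List Entry) (x : ℕ) : Prop := ∃ y ≤ x, ¬ Alive P y

/-- Visiting `q` hits the index `i` of the family `R`. -/
def Hits (R : Fin k → Set S) (q : S) (i : ℕ) : Prop := ∃ j : Fin k, i = j + 1 ∧ q ∈ R j

/-- Names at least this large are not in use between two steps. -/
abbrev bound (S : Type) [Fintype S] (k : ℕ) : ℕ := Fintype.card S * (k + 1)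

/-- The name of a node freshly created for the state `q`. -/
noncomputable def fresh [Fintype S] (k : ℕ) (q : S) : ℕ := bound S k + Fintype.equivFin S q

section Step

variable [Fintype S] (δ : S → A → Set S) (R G : Fin k → Set S) (P : S → List Entry) (a : A)

/-- The branch that `q` inherits from its predecessor `p`. -/
noncomputable def inherit (q p : S) : List Entry :=
  extend k (Hits R q) (Hits G q) (fresh k q) {0} (P p)

/-- `p` is a live predecessor of `q`. -/
def Pred (q p : S) : Prop := P p ≠ [] ∧ q ∈ δ p a

/-- Branches are compared lexicographically, index first. -/
def key (π : List Entry) : List (ℕ ×ₗ ℕ) := π.map toLex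

/-- `p` is a live predecessor of `q` passing on a least branch. -/
def BestPred (q p : S) : Prop :=
  Pred δ P a q p ∧ ∀ p', Pred δ P a q p' → key (inherit R G P q p) ≤ key (inherit R G P q p')

open Classical in
/-- The branches after reading `a`, before green nodes are pruned. -/
noncomputable def raw (q : S) : List Entry :=
  if h : ∃ p, BestPred δ R G P a q p then inherit R G P q h.choose else []

/-- The branches after reading `a`. -/
noncomputable def step : S → List Entry := rename (prune (raw δ R G P a))

end Step

/-- Equal names occur at equal nodes; indices are at most `k`, and a nonzero index does not occur
twice on a branch. -/
structure IsForest (k : ℕ) (P : S → List Entry) : Prop where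
  tree : ∀ v e v' e', IsNode P (v ++ [e]) → IsNode P (v' ++ [e']) → e.2 = e'.2 → v = v' ∧ e = e'
  valid : ∀ v e, IsNode P (v ++ [e]) → e.1 ≤ k ∧ (e.1 ∈ usedFrom {0} v → e.1 = 0)

section Lists

theorem usedFrom_nil (U : Finset ℕ) : usedFrom U [] = U := by simp [usedFrom]

theorem usedFrom_cons (U : Finset ℕ) (e : Entry) (v : List Entry) :
    usedFrom U (e :: v) = usedFrom (insert e.1 U) v := by
  ext; simp [usedFrom]

theorem usedFrom_append (U : Finset ℕ) (v w : List Entry) :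
    usedFrom U (v ++ w) = usedFrom (usedFrom U v) w := by
  ext; simp [usedFrom]

theorem mem_usedFrom {U : Finset ℕ} {v : List Entry} {i : ℕ} :
    i ∈ usedFrom U v ↔ i ∈ U ∨ ∃ e ∈ v, e.1 = i := by
  simp [usedFrom]

theorem nextIdx_le (U : Finset ℕ) (i : ℕ) : nextIdx U i ≤ i - 1 := Nat.findGreatest_le _

theorem nextIdx_mem {U : Finset ℕ} {i : ℕ} (h : nextIdx U i ∈ U) : nextIdx U i = 0 := by
  by_contra h0
  exact Nat.findGreatest_of_ne_zero (P := (· ∉ U)) rfl h0 h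

theorem le_nextIdx {U : Finset ℕ} {i j : ℕ} (hj : j ∉ U) (hji : j < i) : j ≤ nextIdx U i :=
  Nat.le_findGreatest (by omega) hj

theorem extend_spec {Rp Gp : ℕ → Prop} {y : ℕ} (π : List Entry) (U : Finset ℕ)
    (hπ : ∀ v e, v ++ [e] <+: π → e.1 ≤ k ∧ (e.1 ∈ usedFrom U v → e.1 = 0)) :
    ∃ v s, v <+: π ∧ extend k Rp Gp y U π = v ++ s ∧
      ((s = [] ∧ nextIdx (usedFrom U v) (k + 1) = 0) ∨
        ∃ j, s = [(j, y)] ∧ j ≤ k ∧ (j ∈ usedFrom U v → j = 0)) := by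
  induction π generalizing U with
  | nil =>
    refine ⟨[], extend k Rp Gp y U [], List.prefix_rfl, rfl, ?_⟩
    rw [usedFrom_nil, extend]
    split_ifs with h
    · exact Or.inl ⟨rfl, h⟩
    · exact Or.inr ⟨_, rfl, nextIdx_le _ _, nextIdx_mem⟩
  | cons e π ih =>
    have he := hπ [] e ⟨π, rfl⟩
    rw [usedFrom_nil] at he
    rw [extend]
    split_ifs with h1 h2
    · refine ⟨[], _, List.nil_prefix, rfl, Or.inr ⟨_, rfl, ?_, ?_⟩⟩
      · have := nextIdx_le U e.1
        omega
      · rw [usedFrom_nil]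
        exact nextIdx_mem
    · exact ⟨[], _, List.nil_prefix, rfl, Or.inr ⟨_, rfl, he.1, by rw [usedFrom_nil]; exact he.2⟩⟩
    · obtain ⟨v, s, hv, hs, h⟩ := ih (insert e.1 U) (fun v f hv => by
        have := hπ (e :: v) f (by simpa using hv)
        rwa [usedFrom_cons] at this)
      exact ⟨e :: v, s, by simpa using hv, by simp [hs], by rwa [usedFrom_cons]⟩

theorem extend_append {Rp Gp : ℕ → Prop} {y : ℕ} (v w : List Entry) (U : Finset ℕ)
    (hv : ∀ e ∈ v, ¬ Rp e.1 ∧ ¬ Gp e.1) :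
    extend k Rp Gp y U (v ++ w) = v ++ extend k Rp Gp y (usedFrom U v) w := by
  induction v generalizing U with
  | nil => simp [usedFrom_nil]
  | cons e v ih =>
    have he := hv e (by simp)
    rw [List.cons_append, extend, if_neg he.1, if_neg he.2, usedFrom_cons,
      ih _ fun f hf => hv f (by simp [hf])]
    rfl

theorem extend_ne_nil {Rp Gp : ℕ → Prop} {y : ℕ} {U : Finset ℕ} {π : List Entry} (hπ : π ≠ []) :
    extend k Rp Gp y U π ≠ [] := by
  cases π with
  | nil => exact absurd rfl hπ
  | cons e π =>
    rw [extend]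
    split_ifs <;> simp

theorem not_hit_of_mem_extend {Rp Gp : ℕ → Prop} {y x : ℕ} (v : List Entry) (e : Entry)
    (w : List Entry) (U : Finset ℕ) (hx : ∃ f ∈ extend k Rp Gp y U (v ++ e :: w), f.2 = x)
    (hxy : x ≠ y) (hv : ∀ f ∈ v, f.2 ≠ x) :
    ∀ f ∈ v ++ [e], ¬ Rp f.1 ∧ ¬ Gp f.1 := by
  induction v generalizing U with
  | nil =>
    rw [List.nil_append, extend] at hx
    split_ifs at hx with h1 h2
    · simp at hx; exact absurd hx.symm hxy
    · simp at hx; exact absurd hx.symm hxy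
    · simpa using ⟨h1, h2⟩
  | cons f v ih =>
    rw [List.cons_append, extend] at hx
    split_ifs at hx with h1 h2
    · simp at hx; exact absurd hx.symm hxy
    · simp at hx; exact absurd hx.symm hxy
    · obtain ⟨g, hg, hgx⟩ := hx
      rcases List.mem_cons.1 hg with rfl | hg
      · exact absurd hgx (hv g (by simp))
      · intro b hb
        rcases List.mem_cons.1 hb with rfl | hb
        · exact ⟨h1, h2⟩
        · exact ih _ ⟨g, hg, hgx⟩ (fun c hc => hv c (by simp [hc])) b hb

theorem cut_prefix (p : ℕ → Prop) (π : List Entry) : cut p π <+: π := by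
  induction π with
  | nil => simp [cut]
  | cons e π ih =>
    rw [cut]
    split_ifs
    · simp
    · simpa using ih

theorem cut_ne_nil {p : ℕ → Prop} {π : List Entry} (h : π ≠ []) : cut p π ≠ [] := by
  cases π with
  | nil => exact absurd rfl h
  | cons e π => rw [cut]; split_ifs <;> simp

theorem cut_append {p : ℕ → Prop} (v w : List Entry) (hv : ∀ e ∈ v, ¬ p e.2) :
    cut p (v ++ w) = v ++ cut p w := by
  induction v with
  | nil => rfl
  | cons e v ih =>
    rw [List.cons_append, cut, if_neg (hv e (by simp)), ih fun f hf => hv f (by simp [hf])]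
    rfl

/-- Nodes strictly inside a cut branch do not satisfy the cutting condition. -/
theorem not_of_prefix_cut {p : ℕ → Prop} {π v : List Entry} {e : Entry}
    (h : v ++ [e] <+: cut p π) : ∀ f ∈ v, ¬ p f.2 := by
  induction v generalizing π with
  | nil => simp
  | cons f v ih =>
    cases π with
    | nil => simp [cut] at h
    | cons g π =>
      rw [cut] at h
      split_ifs at h with hg
      · simp at h
      · rw [List.cons_append, List.cons_prefix_cons] at h
        obtain ⟨rfl, h⟩ := h
        intro b hb
        rcases List.mem_cons.1 hb with rfl | hb
        · exact hg
        · exact ih h b hb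

theorem IsNode.of_prefix {P : S → List Entry} {v w : List Entry} (h : IsNode P w) (hv : v <+: w) :
    IsNode P v := by
  obtain ⟨q, hq⟩ := h
  exact ⟨q, hv.trans hq⟩

theorem alive_iff {P : S → List Entry} {x : ℕ} :
    Alive P x ↔ ∃ v e, IsNode P (v ++ [e]) ∧ e.2 = x := by
  constructor
  · rintro ⟨q, e, he, rfl⟩
    obtain ⟨v, w, h⟩ := List.append_of_mem he
    exact ⟨v, e, ⟨q, by rw [h]; simp⟩, rfl⟩
  · rintro ⟨v, e, ⟨q, hq⟩, rfl⟩
    exact ⟨q, e, hq.subset (by simp), rfl⟩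

theorem IsNode.alive {P : S → List Entry} {v : List Entry} (h : IsNode P v) {e : Entry}
    (he : e ∈ v) : Alive P e.2 := by
  obtain ⟨q, hq⟩ := h
  exact ⟨q, e, hq.subset he, rfl⟩

theorem IsForest.notMem {P : S → List Entry} (h : IsForest k P) {v : List Entry} {e : Entry}
    (hv : IsNode P (v ++ [e])) : ∀ f ∈ v, f.2 ≠ e.2 := by
  intro f hf hfe
  obtain ⟨v1, v2, rfl⟩ := List.append_of_mem hf
  have h1 : IsNode P (v1 ++ [f]) := hv.of_prefix ⟨v2 ++ [e], by simp⟩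
  have := (h.tree _ _ _ _ h1 hv hfe).1
  have := congrArg List.length this
  simp at this

end Lists

section Invariants

theorem IsForest.mono {P Q : S → List Entry} (h : IsForest k P)
    (hQ : ∀ v, IsNode Q v → IsNode P v) : IsForest k Q where
  tree v e v' e' hv hv' := h.tree v e v' e' (hQ _ hv) (hQ _ hv')
  valid v e hv := h.valid v e (hQ _ hv)

theorem IsNode.of_prune {P : S → List Entry} {v : List Entry} (h : IsNode (prune P) v) :
    IsNode P v := by
  obtain ⟨q, hq⟩ := h
  exact ⟨q, hq.trans (cut_prefix _ _)⟩

theorem IsForest.prune {P : S → List Entry} (h : IsForest k P) : IsForest k (prune P) :=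
  h.mono fun _ => IsNode.of_prune

open Classical in
theorem prefix_rename {P : S → List Entry} {q : S} {v : List Entry} (h : v <+: rename P q) :
    ∃ v', v' <+: P q ∧ v = v'.map fun e => (e.1, Nat.count (Alive P) e.2) := by
  obtain ⟨t, ht⟩ := h
  obtain ⟨v', t', h1, h2, -⟩ := List.map_eq_append_iff.1 ht.symm
  exact ⟨v', ⟨t', h1.symm⟩, h2.symm⟩

theorem usedFrom_map (U : Finset ℕ) (v : List Entry) (f : ℕ → ℕ) :
    usedFrom U (v.map fun e => (e.1, f e.2)) = usedFrom U v := by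
  ext; simp [usedFrom]

theorem IsForest.rename {P : S → List Entry} (h : IsForest k P) : IsForest k (rename P) := by
  classical
  have key : ∀ v e, IsNode (StreettTree.rename P) (v ++ [e]) → ∃ v' e', IsNode P (v' ++ [e']) ∧
      (v = v'.map fun e => (e.1, Nat.count (Alive P) e.2)) ∧
      e = (e'.1, Nat.count (Alive P) e'.2) := by
    rintro v e ⟨q, hq⟩
    obtain ⟨u, hu, h⟩ := prefix_rename hq
    obtain ⟨v', t', rfl, h2, h3⟩ := List.map_eq_append_iff.1 h.symm
    obtain ⟨e', rfl, h4⟩ := List.map_eq_singleton_iff.1 h3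
    exact ⟨v', e', ⟨q, hu⟩, h2.symm, h4.symm⟩
  constructor
  · intro v e v' e' hv hv' hee
    obtain ⟨v1, e1, h1, rfl, rfl⟩ := key v e hv
    obtain ⟨v2, e2, h2, rfl, rfl⟩ := key v' e' hv'
    have := Nat.count_injective (h1.alive (by simp)) (h2.alive (by simp)) hee
    obtain ⟨rfl, rfl⟩ := h.tree _ _ _ _ h1 h2 this
    exact ⟨rfl, rfl⟩
  · intro v e hv
    obtain ⟨v1, e1, h1, rfl, rfl⟩ := key v e hv
    rw [usedFrom_map]
    exact h.valid v1 e1 h1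

/-- After pruning, every node has a run that is not yet done with it. -/
theorem exists_undone (hP : IsForest k P) {x : ℕ} (hx : Alive (prune P) x) :
    ∃ q v e w, prune P q = v ++ e :: w ∧ e.2 = x ∧ ∀ f ∈ w.head?, f.1 ≠ 0 := by
  obtain ⟨v, e, ⟨q, hq⟩, rfl⟩ := alive_iff.1 hx
  have hv := not_of_prefix_cut hq
  by_cases hg : Green P e.2
  · refine ⟨q, v, e, [], ?_, rfl, by simp⟩
    obtain ⟨t, ht⟩ := hq.trans (cut_prefix _ _)
    rw [StreettTree.prune, ← ht, List.append_assoc, cut_append _ _ hv]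
    simp [cut, hg]
  · have hg' := hg
    unfold Green at hg'
    push Not at hg'
    obtain ⟨v', e', f, ⟨q', hq'⟩, hee, hf⟩ := hg'
    have h1 : IsNode P (v' ++ [e']) := ⟨q', List.IsPrefix.trans ⟨[f], by simp⟩ hq'⟩
    obtain ⟨rfl, rfl⟩ := hP.tree _ _ _ _ h1 ⟨q, hq.trans (cut_prefix _ _)⟩ hee
    obtain ⟨t, ht⟩ := hq'
    refine ⟨q', v', e', cut (Green P) (f :: t), ?_, rfl, ?_⟩
    · rw [StreettTree.prune, ← ht, List.append_assoc, cut_append _ _ hv]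
      simp [cut, hg]
    · rw [cut]
      split_ifs <;> simpa using hf

variable [Fintype S] {δ : S → A → Set S} {R G : Fin k → Set S} {P : S → List Entry} {a : A}

theorem bound_le_fresh (q : S) : bound S k ≤ fresh k q := Nat.le_add_right _ _

theorem fresh_injective : Function.Injective (fresh k : S → ℕ) := by
  intro q q' h
  unfold fresh at h
  exact (Fintype.equivFin S).injective (Fin.ext (by omega))

theorem exists_bestPred {q : S} (h : ∃ p, Pred δ P a q p) : ∃ p, BestPred δ R G P a q p := by
  classical
  obtain ⟨p, hp⟩ := h
  obtain ⟨m, hm, hmin⟩ := Finset.exists_min_image (Finset.univ.filter (Pred δ P a q))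
    (fun p => key (inherit R G P q p)) ⟨p, by simpa using hp⟩
  exact ⟨m, by simpa using hm, fun p' hp' => hmin p' (by simpa using hp')⟩

theorem exists_raw_eq {q : S} (h : ∃ p, Pred δ P a q p) :
    ∃ p, BestPred δ R G P a q p ∧ raw δ R G P a q = inherit R G P q p := by
  have h' : ∃ p, BestPred δ R G P a q p := exists_bestPred h
  exact ⟨h'.choose, h'.choose_spec, by rw [raw, dif_pos h']⟩

theorem exists_raw_eq_of_ne_nil {q : S} (h : raw δ R G P a q ≠ []) :
    ∃ p, BestPred δ R G P a q p ∧ raw δ R G P a q = inherit R G P q p := by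
  rw [raw] at h
  split_ifs at h with h'
  · exact ⟨h'.choose, h'.choose_spec, by rw [raw, dif_pos h']⟩
  · exact absurd rfl h

theorem inherit_spec (hP : IsForest k P) (q p : S) :
    ∃ v s, v <+: P p ∧ inherit R G P q p = v ++ s ∧
      ((s = [] ∧ nextIdx (usedFrom {0} v) (k + 1) = 0) ∨
        ∃ j, s = [(j, fresh k q)] ∧ j ≤ k ∧ (j ∈ usedFrom {0} v → j = 0)) :=
  extend_spec _ _ fun v e hv => hP.valid v e ⟨p, hv⟩

/-- A node of the new tree is either inherited or a fresh leaf. -/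
theorem raw_node (hP : IsForest k P) {q : S} {v : List Entry} {e : Entry}
    (h : v ++ [e] <+: raw δ R G P a q) :
    IsNode P (v ++ [e]) ∨
      (e.2 = fresh k q ∧ raw δ R G P a q = v ++ [e] ∧ e.1 ≤ k ∧
        (e.1 ∈ usedFrom {0} v → e.1 = 0)) := by
  have hne : raw δ R G P a q ≠ [] := by
    intro h0
    rw [h0] at h
    simp at h
  obtain ⟨p, -, hp⟩ := exists_raw_eq_of_ne_nil hne
  obtain ⟨w, s, hw, hs, hcase⟩ := inherit_spec (R := R) (G := G) hP q p
  rw [hp, hs] at h ⊢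
  rcases hcase with ⟨rfl, -⟩ | ⟨j, rfl, hj⟩
  · exact Or.inl ⟨p, by simpa using h.trans (by simpa using hw)⟩
  · rcases List.prefix_concat_iff.1 h with h | h
    · obtain ⟨rfl, h2⟩ := List.append_inj' h rfl
      obtain rfl : e = _ := by simpa using h2
      exact Or.inr ⟨rfl, rfl, hj⟩
    · exact Or.inl ⟨p, h.trans hw⟩

theorem isForest_raw (hP : IsForest k P) (hlt : ∀ x, Alive P x → x < bound S k) :
    IsForest k (raw δ R G P a) := by
  constructor
  · rintro v e v' e' ⟨q, hq⟩ ⟨q', hq'⟩ hee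
    rcases raw_node hP hq with h | ⟨h1, h2, -⟩ <;> rcases raw_node hP hq' with h' | ⟨h1', h2', -⟩
    · exact hP.tree _ _ _ _ h h' hee
    · have := hlt _ (h.alive (e := e) (by simp))
      have := bound_le_fresh (k := k) q'
      omega
    · have := hlt _ (h'.alive (e := e') (by simp))
      have := bound_le_fresh (k := k) q
      omega
    · obtain rfl : q = q' := fresh_injective (k := k) (by omega)
      obtain ⟨h3, h4⟩ := List.append_inj' (h2.symm.trans h2') rfl
      exact ⟨h3, by simpa using h4⟩
  · rintro v e ⟨q, hq⟩
    rcases raw_node hP hq with h | ⟨-, -, h⟩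
    · exact hP.valid _ _ h
    · exact h

theorem card_alive_le (hP : IsForest k P) (F : Finset ℕ) (hF : ∀ x ∈ F, Alive (prune P) x) :
    F.card ≤ bound S k := by
  classical
  have hP' := hP.prune
  rcases F.eq_empty_or_nonempty with rfl | ⟨x₀, hx₀⟩
  · simp
  obtain ⟨q₀, -⟩ := hF x₀ hx₀
  have : Nonempty S := ⟨q₀⟩
  choose! q v e w h1 h2 h3 using fun x (hx : x ∈ F) => exists_undone hP (hF x hx)
  have hmaps : ∀ x ∈ F, (q x, (usedFrom {0} (v x ++ [e x])).card) ∈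
      (Finset.univ : Finset S) ×ˢ Finset.Icc 1 (k + 1) := by
    intro x hx
    simp only [Finset.mem_product, Finset.mem_univ, true_and, Finset.mem_Icc]
    refine ⟨Finset.card_pos.2 ⟨0, by simp [mem_usedFrom]⟩, ?_⟩
    have : usedFrom {0} (v x ++ [e x]) ⊆ Finset.range (k + 1) := by
      intro i hi
      rcases mem_usedFrom.1 hi with hi | ⟨f, hf, rfl⟩
      · simp at hi; simp [hi]
      · obtain ⟨v1, v2, hv⟩ := List.append_of_mem hf
        have hn : IsNode (prune P) (v1 ++ [f]) := by
          refine ⟨q x, v2 ++ w x, ?_⟩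
          have := congrArg (· ++ w x) hv
          simpa [h1 x hx] using this.symm
        have := (hP'.valid _ _ hn).1
        simp; omega
    simpa using Finset.card_le_card this
  have hlt : ∀ x ∈ F, ∀ y ∈ F, q x = q y → (v x).length < (v y).length →
      (usedFrom {0} (v x ++ [e x])).card < (usedFrom {0} (v y ++ [e y])).card := by
    intro x hx y hy hq hlen
    have heq : v x ++ e x :: w x = v y ++ e y :: w y := by
      rw [← h1 x hx, ← h1 y hy, hq]
    have hpre : v x ++ [e x] <+: v y := by
      refine List.prefix_of_prefix_length_le (l₃ := v y ++ e y :: w y) ⟨w x, by simpa using heq⟩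
        (List.prefix_append _ _) (by simpa using hlen)
    obtain ⟨u, hu⟩ := hpre
    have hw : w x = u ++ e y :: w y := by
      rw [← hu] at heq
      simpa using heq
    have hf : ∃ f u', u ++ [e y] = f :: u' ∧ f ∈ (w x).head? := by
      cases u with
      | nil => exact ⟨e y, [], rfl, by simp [hw]⟩
      | cons f u => exact ⟨f, u ++ [e y], rfl, by simp [hw]⟩
    obtain ⟨f, u', hu', hfw⟩ := hf
    have hf0 := h3 x hx f hfw
    have hvy : v y ++ [e y] = (v x ++ [e x]) ++ f :: u' := by
      rw [← hu, ← hu']; simp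
    have hn : IsNode (prune P) ((v x ++ [e x]) ++ [f]) := by
      refine ⟨q y, ?_⟩
      rw [h1 y hy]
      exact ⟨u' ++ w y, by
        have := congrArg (· ++ w y) hvy
        simpa using this.symm⟩
    have hnot : f.1 ∉ usedFrom {0} (v x ++ [e x]) := fun h => hf0 ((hP'.valid _ _ hn).2 h)
    rw [hvy]
    refine Finset.card_lt_card ⟨fun i hi => ?_, fun h => hnot (h ?_)⟩
    · rw [usedFrom_append]
      exact mem_usedFrom.2 (Or.inl hi)
    · exact mem_usedFrom.2 (Or.inr ⟨f, by simp, rfl⟩)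
  have hinj : Set.InjOn (fun x => (q x, (usedFrom {0} (v x ++ [e x])).card)) F := by
    intro x hx y hy hxy
    obtain ⟨hq, hc⟩ := Prod.mk.inj hxy
    rcases lt_trichotomy (v x).length (v y).length with h | h | h
    · exact absurd hc (hlt x hx y hy hq h).ne
    · have heq : v x ++ e x :: w x = v y ++ e y :: w y := by
        rw [← h1 x hx, ← h1 y hy, hq]
      have := (List.append_inj heq h).2
      rw [← h2 x hx, ← h2 y hy, (List.cons.inj this).1]
    · exact absurd hc (hlt y hy x hx hq.symm h).ne'
  have := Finset.card_le_card_of_injOn _ hmaps hinj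
  simpa using this

theorem rank_lt (hP : IsForest k P) {x : ℕ} (hx : Alive (prune P) x)
    [DecidablePred (Alive (prune P))] : Nat.count (Alive (prune P)) x < bound S k := by
  have h := card_alive_le (S := S) hP ((Finset.range (x + 1)).filter (Alive (prune P)))
    (by simp)
  rw [← Nat.count_eq_card_filter_range, Nat.count_succ, if_pos hx] at h
  exact h

/-- The invariant of the construction. -/
structure Wf (k : ℕ) (P : S → List Entry) : Prop where
  forest : IsForest k P
  lt : ∀ x, Alive P x → x < bound S k

theorem Wf.step (hP : Wf k P) : Wf k (step δ R G P a) := by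
  classical
  have hf := isForest_raw (δ := δ) (R := R) (G := G) (a := a) hP.forest hP.lt
  refine ⟨hf.prune.rename, ?_⟩
  rintro x ⟨q, e, he, rfl⟩
  obtain ⟨f, hf', rfl⟩ := List.mem_map.1 he
  exact rank_lt hf ⟨q, f, hf', rfl⟩

end Invariants

section Counting

variable [Fintype S]

open Classical in
/-- The name of the parent of the node named `x`, and `x` itself at the root. -/
noncomputable def parentCode (k : ℕ) (P : S → List Entry) (x : Fin (bound S k)) :
    Fin (bound S k) :=
  if h : ∃ y : Fin (bound S k), ∃ (v : List Entry) (f e : Entry), IsNode P (v ++ [f, e]) ∧ f.2 = y ∧ e.2 = x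
  then h.choose else x

open Classical in
/-- The index of the node named `x`. -/
noncomputable def idxCode (k : ℕ) (P : S → List Entry) (x : Fin (bound S k)) : Fin (k + 1) :=
  if h : ∃ i : Fin (k + 1), ∃ (v : List Entry) (e : Entry), IsNode P (v ++ [e]) ∧ e.1 = i ∧ e.2 = x
  then h.choose else 0

open Classical in
/-- The name of the last node on the branch of `q`. -/
noncomputable def leafCode (k : ℕ) (P : S → List Entry) (q : S) : Option (Fin (bound S k)) :=
  if h : ∃ y : Fin (bound S k), ∃ (v : List Entry) (e : Entry), P q = v ++ [e] ∧ e.2 = y then some h.choose else none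

theorem parentCode_of_node {P : S → List Entry} (hP : Wf k P) {x : Fin (bound S k)}
    {v : List Entry} {f e : Entry} (h : IsNode P (v ++ [f, e])) (hx : e.2 = x) :
    (parentCode k P x : ℕ) = f.2 := by
  have h' : ∃ y : Fin (bound S k), ∃ (v : List Entry) (f e : Entry), IsNode P (v ++ [f, e]) ∧ f.2 = y ∧ e.2 = x :=
    ⟨⟨f.2, hP.lt _ (h.alive (by simp))⟩, v, f, e, h, rfl, hx⟩
  rw [parentCode, dif_pos h']
  obtain ⟨v1, f1, e1, h1, h2, h3⟩ := h'.choose_spec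
  rw [← h2]
  have h4 := (hP.forest.tree (v ++ [f]) e (v1 ++ [f1]) e1 (by simpa using h) (by simpa using h1)
    (by omega)).1
  have h5 := (List.append_inj' h4 rfl).2
  simp at h5
  rw [h5]

theorem parentCode_of_root {P : S → List Entry} (hP : Wf k P) {x : Fin (bound S k)} {e : Entry}
    (h : IsNode P [e]) (hx : e.2 = x) : parentCode k P x = x := by
  rw [parentCode, dif_neg]
  rintro ⟨y, v1, f1, e1, h1, h2, h3⟩
  have h4 := (hP.forest.tree [] e (v1 ++ [f1]) e1 (by simpa using h) (by simpa using h1)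
    (by omega)).1
  simp at h4

theorem idxCode_of_node {P : S → List Entry} (hP : Wf k P) {x : Fin (bound S k)}
    {v : List Entry} {e : Entry} (h : IsNode P (v ++ [e])) (hx : e.2 = x) :
    (idxCode k P x : ℕ) = e.1 := by
  have h' : ∃ i : Fin (k + 1), ∃ (v : List Entry) (e : Entry), IsNode P (v ++ [e]) ∧ e.1 = i ∧ e.2 = x :=
    ⟨⟨e.1, Nat.lt_succ_of_le (hP.forest.valid _ _ h).1⟩, v, e, h, rfl, hx⟩
  rw [idxCode, dif_pos h']
  obtain ⟨v1, e1, h1, h2, h3⟩ := h'.choose_spec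
  rw [← h2, (hP.forest.tree _ _ _ _ h h1 (by omega)).2]

theorem leafCode_nil {P : S → List Entry} {q : S} (h : P q = []) : leafCode k P q = none := by
  rw [leafCode, dif_neg]
  rintro ⟨y, v, e, hv, -⟩
  simp [h] at hv

theorem leafCode_append {P : S → List Entry} (hP : Wf k P) {q : S} {v : List Entry} {e : Entry}
    (h : P q = v ++ [e]) : ∃ y : Fin (bound S k), leafCode k P q = some y ∧ e.2 = y := by
  have h' : ∃ y : Fin (bound S k), ∃ (v : List Entry) (e : Entry), P q = v ++ [e] ∧ e.2 = y :=
    ⟨⟨e.2, hP.lt _ ⟨q, e, by simp [h], rfl⟩⟩, v, e, h, rfl⟩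
  refine ⟨h'.choose, by rw [leafCode, dif_pos h'], ?_⟩
  obtain ⟨v1, e1, h1, h2⟩ := h'.choose_spec
  rw [← h2]
  have := (List.append_inj' (h.symm.trans h1) rfl).2
  simp at this
  rw [this]

theorem node_eq_of_code {P Q : S → List Entry} (hP : Wf k P) (hQ : Wf k Q)
    (hpar : parentCode k P = parentCode k Q) (hidx : idxCode k P = idxCode k Q)
    (v : List Entry) :
    ∀ e v' e', IsNode P (v ++ [e]) → IsNode Q (v' ++ [e']) → e.2 = e'.2 →
      v ++ [e] = v' ++ [e'] := by
  induction v using List.reverseRecOn with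
  | nil =>
    intro e v' e' h h' hee
    have hx := hP.lt _ (h.alive (e := e) (by simp))
    have h1 := idxCode_of_node hP (x := ⟨e.2, hx⟩) h rfl
    have h2 := idxCode_of_node hQ (x := ⟨e.2, hx⟩) h' hee.symm
    rw [hidx, h2] at h1
    have he : e = e' := Prod.ext h1.symm hee
    subst he
    rcases List.eq_nil_or_concat v' with rfl | ⟨w, f, rfl⟩
    · rfl
    · have h3 := parentCode_of_root hP (x := ⟨e.2, hx⟩) h rfl
      have h4 := parentCode_of_node hQ (x := ⟨e.2, hx⟩) (v := w) (f := f) (e := e)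
        (by simpa using h') rfl
      rw [← hpar, h3] at h4
      exact absurd h4.symm (hQ.forest.notMem h' f (by simp))
  | append_singleton v f ih =>
    intro e v' e' h h' hee
    have hx := hP.lt _ (h.alive (e := e) (by simp))
    have h1 := idxCode_of_node hP (x := ⟨e.2, hx⟩) h rfl
    have h2 := idxCode_of_node hQ (x := ⟨e.2, hx⟩) h' hee.symm
    rw [hidx, h2] at h1
    have he : e = e' := Prod.ext h1.symm hee
    subst he
    have h4 := parentCode_of_node hP (x := ⟨e.2, hx⟩) (v := v) (f := f) (e := e)
      (by simpa using h) rfl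
    rcases List.eq_nil_or_concat v' with rfl | ⟨w, g, rfl⟩
    · have h3 := parentCode_of_root hQ (x := ⟨e.2, hx⟩) h' rfl
      rw [hpar, h3] at h4
      exact absurd h4.symm (hP.forest.notMem h f (by simp))
    · have h5 := parentCode_of_node hQ (x := ⟨e.2, hx⟩) (v := w) (f := g) (e := e)
        (by simpa using h') rfl
      have := ih f w g (h.of_prefix ⟨[e], rfl⟩)
        (h'.of_prefix ⟨[e], by simp⟩) (by rw [← h4, ← h5, hpar])
      rw [this]
      simp

/-- The finite description of a Streett tree. -/
noncomputable def code (k : ℕ) (P : {P : S → List Entry // Wf k P}) :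
    (Fin (bound S k) → Fin (bound S k)) × (Fin (bound S k) → Fin (k + 1)) ×
      (S → Option (Fin (bound S k))) :=
  (parentCode k P.1, idxCode k P.1, leafCode k P.1)

theorem code_injective : Function.Injective (code (S := S) k) := by
  rintro ⟨P, hP⟩ ⟨Q, hQ⟩ h
  simp only [code, Prod.mk.injEq] at h
  obtain ⟨hpar, hidx, hleaf⟩ := h
  refine Subtype.ext (funext fun q => ?_)
  have hq := congrFun hleaf q
  change P q = Q q
  rcases List.eq_nil_or_concat (P q) with h1 | ⟨v, e, h1⟩ <;>
    rcases List.eq_nil_or_concat (Q q) with h2 | ⟨w, f, h2⟩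
  · rw [h1, h2]
  · obtain ⟨y, h3, -⟩ := leafCode_append hQ (by simpa using h2)
    rw [leafCode_nil h1, h3] at hq
    simp at hq
  · obtain ⟨y, h3, -⟩ := leafCode_append hP (by simpa using h1)
    rw [leafCode_nil h2, h3] at hq
    simp at hq
  · rw [List.concat_eq_append] at h1 h2
    obtain ⟨y, h3, h4⟩ := leafCode_append hP h1
    obtain ⟨z, h5, h6⟩ := leafCode_append hQ h2
    rw [h3, h5] at hq
    rw [h1, h2]
    refine node_eq_of_code hP hQ hpar hidx v e w f ⟨q, by rw [h1]⟩ ⟨q, by rw [h2]⟩ ?_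
    rw [h4, h6, Option.some.inj hq]

open Classical in
noncomputable instance : Fintype {P : S → List Entry // Wf k P} :=
  Fintype.ofInjective (code k) code_injective

theorem card_wf_le : Fintype.card {P : S → List Entry // Wf k P} ≤
    bound S k ^ bound S k * ((k + 1) ^ bound S k * (bound S k + 1) ^ Fintype.card S) := by
  classical
  refine (Fintype.card_le_of_injective (code k) code_injective).trans ?_
  simp

theorem state_count_le (n k : ℕ) (hn : 1 ≤ n) :
    (n * (k + 1)) ^ (n * (k + 1)) * ((k + 1) ^ (n * (k + 1)) * (n * (k + 1) + 1) ^ n) *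
      (2 ^ (n * (k + 1)) * 2 ^ (n * (k + 1))) ≤
    12 ^ (n * (k + 1)) * n ^ n * (k + 1) ^ (n * (k + 1)) * (n * (k + 1)) ^ (n * (k + 1)) := by
  have h1 : (n * (k + 1) + 1) ^ n ≤ n ^ n * 2 ^ (n * (k + 1)) := by
    have hk : k + 1 ≤ 2 ^ k := Nat.lt_two_pow_self
    calc (n * (k + 1) + 1) ^ n ≤ (n * 2 ^ (k + 1)) ^ n := by
          refine Nat.pow_le_pow_left ?_ n
          have : 1 ≤ n * (k + 1) := Nat.mul_pos hn (Nat.succ_pos k)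
          have := Nat.mul_le_mul_left n hk
          rw [pow_succ]
          nlinarith
      _ = n ^ n * 2 ^ (n * (k + 1)) := by rw [mul_pow, ← pow_mul, mul_comm (k + 1) n]
  have h2 : 2 ^ (n * (k + 1)) * (2 ^ (n * (k + 1)) * 2 ^ (n * (k + 1))) ≤ 12 ^ (n * (k + 1)) := by
    rw [← mul_pow, ← mul_pow]
    exact Nat.pow_le_pow_left (by norm_num) _
  generalize n * (k + 1) = m at *
  calc m ^ m * ((k + 1) ^ m * (m + 1) ^ n) * (2 ^ m * 2 ^ m)
      ≤ m ^ m * ((k + 1) ^ m * (n ^ n * 2 ^ m)) * (2 ^ m * 2 ^ m) := by gcongr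
    _ = (2 ^ m * (2 ^ m * 2 ^ m)) * n ^ n * (k + 1) ^ m * m ^ m := by ring
    _ ≤ _ := by gcongr

end Counting

section Sequences

theorem infOcc_inter_nonempty_iff [Finite S] (r : ℕ → S) (X : Set S) :
    (InfOcc r ∩ X).Nonempty ↔ ∀ N, ∃ t, N ≤ t ∧ r t ∈ X := by
  constructor
  · rintro ⟨s, hs, hX⟩ N
    obtain ⟨t, ht, rfl⟩ := hs N
    exact ⟨t, ht, hX⟩
  · intro h
    by_contra hne
    have hfin : ∀ s ∈ X, ∃ N, ∀ t, N ≤ t → r t ≠ s := by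
      intro s hs
      by_contra hcon
      push Not at hcon
      exact hne ⟨s, hcon, hs⟩
    choose! N hN using hfin
    obtain ⟨M, hM⟩ := (Set.finite_range N).bddAbove
    obtain ⟨t, ht, hX⟩ := h M
    exact hN _ hX t ((hM ⟨r t, rfl⟩).trans ht) rfl

theorem infOcc_inter_eq_empty_iff [Finite S] (r : ℕ → S) (X : Set S) :
    InfOcc r ∩ X = ∅ ↔ ∃ N, ∀ t, N ≤ t → r t ∉ X := by
  rw [← Set.not_nonempty_iff_eq_empty, infOcc_inter_nonempty_iff]
  push Not
  rfl

theorem exists_eventually_const (f : ℕ → ℕ) (T : ℕ) (h : ∀ t, T ≤ t → f (t + 1) ≤ f t) :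
    ∃ T', T ≤ T' ∧ ∀ t, T' ≤ t → f t = f T' := by
  have hne : ({m | ∃ t, T ≤ t ∧ f t = m} : Set ℕ).Nonempty := ⟨f T, T, le_rfl, rfl⟩
  obtain ⟨T', hT', hm⟩ := Nat.sInf_mem hne
  refine ⟨T', hT', fun t ht => le_antisymm ?_ ?_⟩
  · induction t, ht using Nat.le_induction with
    | base => exact le_rfl
    | succ t ht ih => exact (h t (hT'.trans ht)).trans ih
  · rw [hm]
    exact Nat.sInf_le ⟨t, hT'.trans ht, rfl⟩

/-- König's lemma for a layered graph on a finite set of states. -/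
theorem exists_infinite_path [Finite S] (L : ℕ → Set S) (E : ℕ → S → S → Prop)
    (hne : ∀ N, ∃ t, N ≤ t ∧ (L t).Nonempty)
    (hE : ∀ t, ∀ q ∈ L (t + 1), ∃ p ∈ L t, E t p q) :
    ∃ r : ℕ → S, ∀ t, r t ∈ L t ∧ E t (r t) (r (t + 1)) := by
  classical
  have hchain : ∀ t, ∀ q ∈ L t, ∃ r : ℕ → S, r t = q ∧ (∀ s ≤ t, r s ∈ L s) ∧
      ∀ s < t, E s (r s) (r (s + 1)) := by
    intro t
    induction t with
    | zero => exact fun q hq => ⟨fun _ => q, rfl, fun s hs => by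
        obtain rfl : s = 0 := by omega
        exact hq, fun s hs => by omega⟩
    | succ t ih =>
      intro q hq
      obtain ⟨p, hp, hpq⟩ := hE t q hq
      obtain ⟨r, hr, h1, h2⟩ := ih p hp
      refine ⟨Function.update r (t + 1) q, by simp, fun s hs => ?_, fun s hs => ?_⟩
      · rcases eq_or_lt_of_le hs with rfl | hs
        · simpa using hq
        · rw [Function.update_of_ne (by omega)]
          exact h1 s (by omega)
      · rw [Function.update_of_ne (by omega)]
        rcases eq_or_lt_of_le (Nat.le_of_lt_succ hs) with rfl | hs
        · simpa [hr] using hpq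
        · rw [Function.update_of_ne (by omega)]
          exact h2 s hs
  let _ : TopologicalSpace S := ⊥
  have : DiscreteTopology S := ⟨rfl⟩
  let C : ℕ → Set (ℕ → S) := fun N => {r | ∀ s < N, r s ∈ L s ∧ E s (r s) (r (s + 1))}
  have hclosed : ∀ N, IsClosed (C N) := by
    intro N
    have : C N = ⋂ s, ⋂ (_ : s < N),
        (fun r : ℕ → S => (r s, r (s + 1))) ⁻¹' {x | x.1 ∈ L s ∧ E s x.1 x.2} := by
      ext r
      simp [C]
    rw [this]
    exact isClosed_iInter fun s => isClosed_iInter fun _ =>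
      (isClosed_discrete _).preimage (by fun_prop)
  obtain ⟨r, hr⟩ := IsCompact.nonempty_iInter_of_sequence_nonempty_isCompact_isClosed C
    (fun N r hr s hs => hr s (by omega))
    (fun N => by
      obtain ⟨t, ht, q, hq⟩ := hne N
      obtain ⟨r, -, h1, h2⟩ := hchain t q hq
      exact ⟨r, fun s hs => ⟨h1 s (by omega), h2 s (by omega)⟩⟩)
    ((hclosed 0).isCompact) hclosed
  exact ⟨r, fun t => Set.mem_iInter.1 hr (t + 1) t (by omega)⟩

end Sequences

section Correctness

theorem not_hits_zero (R : Fin k → Set S) (q : S) : ¬ Hits R q 0 := by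
  rintro ⟨j, hj, -⟩
  omega

theorem alive_of_not_bad {P : S → List Entry} {x : ℕ} (h : ¬ Bad P x) : Alive P x := by
  by_contra hx
  exact h ⟨x, le_rfl, hx⟩

theorem count_of_not_bad {P : S → List Entry} {x : ℕ} (h : ¬ Bad P x)
    [DecidablePred (Alive P)] : Nat.count (Alive P) x = x := by
  rw [Nat.count_iff_forall]
  intro y hy
  by_contra hx
  exact h ⟨y, hy.le, hx⟩

theorem not_bad_of_count {P : S → List Entry} {x : ℕ} [DecidablePred (Alive P)]
    (hx : Alive P x) (h : Nat.count (Alive P) x = x) : ¬ Bad P x := by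
  rintro ⟨y, hy, hyx⟩
  rcases eq_or_lt_of_le hy with rfl | hy
  · exact hyx hx
  · exact hyx (Nat.count_iff_forall.1 h y hy)

theorem eq_of_count_of_not_bad {P : S → List Entry} {x y : ℕ} [DecidablePred (Alive P)]
    (h : ¬ Bad P x) (hy : Alive P y) (hyx : Nat.count (Alive P) y = x) : y = x :=
  Nat.count_injective hy (alive_of_not_bad h) (hyx.trans (count_of_not_bad h).symm)

theorem prefix_of_prefix_rename {P : S → List Entry} {q : S} {v : List Entry}
    (h : v <+: rename P q) (hv : ∀ e ∈ v, ¬ Bad P e.2) : v <+: P q := by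
  classical
  obtain ⟨v', hv', rfl⟩ := prefix_rename h
  have : v'.map (fun e => (e.1, Nat.count (Alive P) e.2)) = v' := by
    conv_rhs => rw [← List.map_id v']
    refine List.map_congr_left fun e he => ?_
    have := eq_of_count_of_not_bad (hv _ (List.mem_map.2 ⟨e, he, rfl⟩))
      ⟨q, e, hv'.subset he, rfl⟩ rfl
    exact Prod.ext rfl this.symm
  convert hv' using 1

/-- The initial tree: a root containing the initial state. -/
noncomputable def initial (s0 : S) : S → List Entry :=
  open Classical in fun q => if q = s0 then [(0, 0)] else []

variable [Fintype S] {δ : S → A → Set S} {R G : Fin k → Set S} {P : S → List Entry} {a : A}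

theorem wf_initial (s0 : S) : Wf k (initial s0) := by
  have hnode : ∀ v e, IsNode (initial s0) (v ++ [e]) → v = [] ∧ e = (0, 0) := by
    rintro v e ⟨q, hq⟩
    unfold initial at hq
    split_ifs at hq
    · cases v with
      | nil => simpa using hq
      | cons f v => simp at hq
    · simp at hq
  refine ⟨⟨?_, ?_⟩, ?_⟩
  · intro v e v' e' h h' _
    obtain ⟨rfl, rfl⟩ := hnode v e h
    obtain ⟨rfl, rfl⟩ := hnode v' e' h'
    exact ⟨rfl, rfl⟩
  · intro v e h
    obtain ⟨rfl, rfl⟩ := hnode v e h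
    simp
  · intro x hx
    obtain ⟨v, e, h, rfl⟩ := alive_iff.1 hx
    obtain ⟨rfl, rfl⟩ := hnode v e h
    exact Nat.mul_pos (Fintype.card_pos_iff.2 ⟨s0⟩) (Nat.succ_pos k)

theorem mem_raw_of_mem_step {q : S} {x : ℕ} (hbad : ¬ Bad (prune (raw δ R G P a)) x)
    (hx : ∃ e ∈ step δ R G P a q, e.2 = x) :
    ∃ e ∈ prune (raw δ R G P a) q, e.2 = x := by
  classical
  obtain ⟨e, he, hex⟩ := hx
  obtain ⟨f, hf, rfl⟩ := List.mem_map.1 he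
  exact ⟨f, hf, eq_of_count_of_not_bad hbad ⟨q, f, hf, rfl⟩ hex⟩

theorem raw_ne_nil_of_step_ne_nil {q : S} (h : step δ R G P a q ≠ []) :
    raw δ R G P a q ≠ [] := by
  intro h0
  exact h (by simp [step, rename, prune, h0, cut])

theorem step_ne_nil {p q : S} (hp : Pred δ P a q p) : step δ R G P a q ≠ [] := by
  obtain ⟨p', hp', h⟩ := exists_raw_eq (R := R) (G := G) ⟨p, hp⟩
  have h1 : raw δ R G P a q ≠ [] := by
    rw [h]
    exact extend_ne_nil hp'.1.1
  have h2 : prune (raw δ R G P a) q ≠ [] := cut_ne_nil h1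
  simpa [step, rename] using h2

theorem mem_of_mem_inherit (hP : IsForest k P) {p q : S} {x : ℕ} (hx : x < bound S k)
    (h : ∃ e ∈ inherit R G P q p, e.2 = x) : ∃ e ∈ P p, e.2 = x := by
  obtain ⟨e, he, rfl⟩ := h
  obtain ⟨v, s, hv, hs, hcase⟩ := inherit_spec (R := R) (G := G) hP q p
  rw [hs] at he
  rcases List.mem_append.1 he with he | he
  · exact ⟨e, hv.subset he, rfl⟩
  · rcases hcase with ⟨rfl, -⟩ | ⟨j, rfl, -⟩
    · simp at he
    · rw [List.mem_singleton.1 he] at hx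
      have := bound_le_fresh (k := k) q
      simp only at hx
      omega

theorem le_extend_head {Rp Gp : ℕ → Prop} {y i : ℕ} {U : Finset ℕ} {u : List Entry}
    (hi : 0 < i) (hik : i ≤ k) (hiU : i ∉ U) (hR : ¬ Rp i) (hu : ∀ f ∈ u.head?, i ≤ f.1) :
    ∃ f w, extend k Rp Gp y U u = f :: w ∧ i ≤ f.1 := by
  cases u with
  | nil =>
    have := le_nextIdx hiU (Nat.lt_succ_of_le hik)
    rw [extend, if_neg (by simp only [Nat.succ_eq_add_one] at this; omega)]
    exact ⟨_, _, rfl, this⟩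
  | cons e u =>
    have he := hu e (by simp)
    rw [extend]
    split_ifs with h1 h2
    · refine ⟨_, _, rfl, le_nextIdx hiU (lt_of_le_of_ne he ?_)⟩
      rintro h
      exact hR (h ▸ h1)
    · exact ⟨_, _, rfl, he⟩
    · exact ⟨_, _, rfl, he⟩

/-- A run staying in a stable node `x` hits no index on the branch up to `x`. -/
theorem step_stable (hP : Wf k P) {p q : S} {x : ℕ} (hx : x < bound S k)
    (hpq : raw δ R G P a q = inherit R G P q p) (hbad : ¬ Bad (prune (raw δ R G P a)) x)
    (hq : ∃ e ∈ step δ R G P a q, e.2 = x) {v : List Entry} {e : Entry} {u : List Entry}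
    (hp : P p = v ++ e :: u) (he : e.2 = x) :
    (∀ f ∈ v ++ [e], ¬ Hits R q f.1 ∧ ¬ Hits G q f.1) ∧
    raw δ R G P a q = v ++ e :: extend k (Hits R q) (Hits G q) (fresh k q)
      (usedFrom {0} (v ++ [e])) u ∧
    ∃ v' e' u', step δ R G P a q = v' ++ e' :: u' ∧ e'.2 = x ∧
      usedFrom {0} (v' ++ [e']) = usedFrom {0} (v ++ [e]) ∧
      (Green (raw δ R G P a) x → u' = []) ∧
      ∀ f' ∈ u'.head?, ∃ f ∈ (extend k (Hits R q) (Hits G q) (fresh k q)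
        (usedFrom {0} (v ++ [e])) u).head?, f'.1 = f.1 := by
  classical
  obtain ⟨g, hg, hgx⟩ := mem_raw_of_mem_step hbad hq
  have hnode : IsNode P (v ++ [e]) := ⟨p, by rw [hp]; simp⟩
  have hxf : x ≠ fresh k q := by
    have := bound_le_fresh (k := k) q
    omega
  have hmem : ∃ f ∈ inherit R G P q p, f.2 = x :=
    ⟨g, by rw [← hpq]; exact (cut_prefix _ _).subset hg, hgx⟩
  have hhits : ∀ f ∈ v ++ [e], ¬ Hits R q f.1 ∧ ¬ Hits G q f.1 := by
    unfold inherit at hmem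
    rw [hp] at hmem
    exact not_hit_of_mem_extend v e u _ hmem hxf fun f hf => he ▸ hP.forest.notMem hnode f hf
  have hraw : raw δ R G P a q = v ++ e :: extend k (Hits R q) (Hits G q) (fresh k q)
      (usedFrom {0} (v ++ [e])) u := by
    rw [hpq, inherit, hp, show v ++ e :: u = (v ++ [e]) ++ u by simp, extend_append _ _ _ hhits]
    simp
  refine ⟨hhits, hraw, ?_⟩
  generalize extend k (Hits R q) (Hits G q) (fresh k q) (usedFrom {0} (v ++ [e])) u = u1 at *
  have hforest := isForest_raw (δ := δ) (R := R) (G := G) (a := a) hP.forest hP.lt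
  obtain ⟨v1, t, hv1⟩ := List.append_of_mem hg
  have hpre : v1 ++ [g] <+: prune (raw δ R G P a) q := ⟨t, by rw [hv1]; simp⟩
  obtain ⟨rfl, rfl⟩ := hforest.tree v1 g v e ⟨q, hpre.trans (cut_prefix _ _)⟩
    ⟨q, by rw [hraw]; simp⟩ (hgx.trans he.symm)
  have hcut : prune (raw δ R G P a) q = v1 ++ cut (Green (raw δ R G P a)) (g :: u1) := by
    unfold prune at hpre ⊢
    rw [hraw, cut_append _ _ (not_of_prefix_cut hpre)]
  have hstep : step δ R G P a q = v1.map
      (fun e => (e.1, Nat.count (Alive (prune (raw δ R G P a))) e.2)) ++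
      (cut (Green (raw δ R G P a)) (g :: u1)).map
        fun e => (e.1, Nat.count (Alive (prune (raw δ R G P a))) e.2) := by
    rw [← List.map_append, ← hcut]
    unfold step rename
    congr!
  rw [cut, he] at hstep
  have hused : usedFrom {0} (v1.map
      (fun e => (e.1, Nat.count (Alive (prune (raw δ R G P a))) e.2)) ++
      [(g.1, Nat.count (Alive (prune (raw δ R G P a))) g.2)]) = usedFrom {0} (v1 ++ [g]) := by
    rw [← usedFrom_map _ (v1 ++ [g]) (Nat.count (Alive (prune (raw δ R G P a))))]
    simp
  have hcount : Nat.count (Alive (prune (raw δ R G P a))) g.2 = x := by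
    rw [hgx]
    exact count_of_not_bad hbad
  split_ifs at hstep with hgr
  · exact ⟨_, _, [], hstep, hcount, hused, fun _ => rfl, by simp⟩
  · refine ⟨_, _, _, hstep, hcount, hused, fun h => absurd h hgr, ?_⟩
    intro f' hf'
    cases u1 with
    | nil => simp [cut] at hf'
    | cons f u1 =>
      refine ⟨f, by simp, ?_⟩
      rw [cut] at hf'
      split_ifs at hf' <;> (simp at hf'; rw [← hf'])

theorem mem_language_of_green {w : ℕ → A} {s0 : S} {P : ℕ → S → List Entry}
    (h0 : P 0 = initial s0) (hs : ∀ t, P (t + 1) = step δ R G (P t) (w t))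
    (hwf : ∀ t, Wf k (P t)) {x T : ℕ} (hx : x < bound S k)
    (hbad : ∀ t, T ≤ t → ¬ Bad (prune (raw δ R G (P t) (w t))) x)
    (hgreen : ∀ N, ∃ t, N ≤ t ∧ Green (raw δ R G (P t) (w t)) x) :
    w ∈ StreettLang δ s0 R G := by
  classical
  obtain ⟨r, hr⟩ := exists_infinite_path
    (fun t => {q | P t q ≠ [] ∧ (T < t → ∃ e ∈ P t q, e.2 = x)})
    (fun t p q => q ∈ δ p (w t) ∧ raw δ R G (P t) (w t) q = inherit R G (P t) q p)
    (by
      intro N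
      obtain ⟨q, e, he, hex⟩ := alive_of_not_bad (hbad (max N T) (le_max_right _ _))
      have hmem : (e.1, x) ∈ P (max N T + 1) q := by
        rw [hs]
        refine List.mem_map.2 ⟨e, he, Prod.ext rfl ?_⟩
        rw [hex]
        exact count_of_not_bad (hbad (max N T) (le_max_right _ _))
      exact ⟨max N T + 1, by omega, q, List.ne_nil_of_mem hmem, fun _ => ⟨_, hmem, rfl⟩⟩)
    (by
      rintro t q ⟨hq, hqx⟩
      rw [hs] at hq hqx
      obtain ⟨p, hp, hpq⟩ := exists_raw_eq_of_ne_nil (raw_ne_nil_of_step_ne_nil hq)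
      refine ⟨p, ⟨hp.1.1, fun ht => ?_⟩, hp.1.2, hpq⟩
      obtain ⟨e, he, hex⟩ := mem_raw_of_mem_step (hbad t ht.le) (hqx (by omega))
      exact mem_of_mem_inherit (hwf t).forest hx
        ⟨e, by rw [← hpq]; exact (cut_prefix _ _).subset he, hex⟩)
  have hstable := fun t (ht : T < t) v e u (hp : P t (r t) = v ++ e :: u) (he : e.2 = x) =>
    step_stable (hwf t) hx (hr t).2.2 (hbad t ht.le)
      (by rw [← hs]; exact (hr (t + 1)).1.2 (by omega)) hp he
  obtain ⟨e₀, he₀, hx₀⟩ := (hr (T + 1)).1.2 (by omega)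
  obtain ⟨v₀, u₀, hv₀⟩ := List.append_of_mem he₀
  set U := usedFrom {0} (v₀ ++ [e₀]) with hU
  have hdec : ∀ t, T < t → ∃ v e u, P t (r t) = v ++ e :: u ∧ e.2 = x ∧
      usedFrom {0} (v ++ [e]) = U := by
    intro t ht
    induction t, ht using Nat.le_induction with
    | base => exact ⟨v₀, e₀, u₀, hv₀, hx₀, rfl⟩
    | succ t ht ih =>
      obtain ⟨v, e, u, h1, h2, h3⟩ := ih
      obtain ⟨-, -, v', e', u', h4, h5, h6, -⟩ := hstable t ht v e u h1 h2
      exact ⟨v', e', u', by rw [hs, h4], h5, h6.trans h3⟩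
  refine ⟨r, ⟨?_, fun t => (hr t).2.1⟩, fun j => ?_⟩
  · have := (hr 0).1.1
    rw [h0, initial] at this
    by_contra hne
    simp [hne] at this
  by_cases hj : (j : ℕ) + 1 ∈ U
  · left
    rw [infOcc_inter_eq_empty_iff]
    refine ⟨T + 2, fun t ht hmem => ?_⟩
    obtain ⟨t, rfl⟩ : ∃ t', t = t' + 1 := ⟨t - 1, by omega⟩
    obtain ⟨v, e, u, h1, h2, h3⟩ := hdec t (by omega)
    obtain ⟨hhits, -⟩ := hstable t (by omega) v e u h1 h2
    rw [← h3] at hj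
    rcases mem_usedFrom.1 hj with hj | ⟨f, hf, hfj⟩
    · simp at hj
    · exact (hhits f hf).2 ⟨j, hfj, hmem⟩
  · right
    rw [infOcc_inter_nonempty_iff]
    by_contra hcon
    push Not at hcon
    obtain ⟨N, hN⟩ := hcon
    have hR : ∀ t, N ≤ t → ¬ Hits R (r t) (j + 1) := by
      rintro t ht ⟨j', hj', hmem⟩
      obtain rfl : j = j' := Fin.ext (by omega)
      exact hN t ht hmem
    obtain ⟨t₁, ht₁, hg₁⟩ := hgreen (max N (T + 1))
    have hwait : ∀ t, t₁ < t → ∃ v e u, P t (r t) = v ++ e :: u ∧ e.2 = x ∧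
        usedFrom {0} (v ++ [e]) = U ∧ ∀ f ∈ u.head?, (j : ℕ) + 1 ≤ f.1 := by
      intro t ht
      induction t, ht using Nat.le_induction with
      | base =>
        obtain ⟨v, e, u, h1, h2, h3⟩ := hdec t₁ (by omega)
        obtain ⟨-, -, v', e', u', h4, h5, h6, h7, -⟩ := hstable t₁ (by omega) v e u h1 h2
        exact ⟨v', e', u', by rw [hs, h4], h5, h6.trans h3, by simp [h7 hg₁]⟩
      | succ t ht ih =>
        obtain ⟨v, e, u, h1, h2, h3, h8⟩ := ih
        obtain ⟨-, -, v', e', u', h4, h5, h6, -, h7⟩ := hstable t (by omega) v e u h1 h2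
        refine ⟨v', e', u', by rw [hs, h4], h5, h6.trans h3, fun f' hf' => ?_⟩
        obtain ⟨f, hf, hff⟩ := h7 f' hf'
        obtain ⟨f1, w1, hw1, hf1⟩ := le_extend_head (k := k) (Rp := Hits R (r (t + 1)))
          (Gp := Hits G (r (t + 1))) (y := fresh k (r (t + 1))) (Nat.succ_pos j)
          (Nat.succ_le_of_lt j.2) (h3 ▸ hj) (hR _ (by omega)) h8
        rw [hw1] at hf
        obtain rfl : f1 = f := by simpa using hf
        omega
    obtain ⟨t₂, ht₂, hg₂⟩ := hgreen (t₁ + 1)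
    obtain ⟨v, e, u, h1, h2, h3, h8⟩ := hwait t₂ ht₂
    obtain ⟨-, hraw, -⟩ := hstable t₂ (by omega) v e u h1 h2
    obtain ⟨f1, w1, hw1, hf1⟩ := le_extend_head (k := k) (Rp := Hits R (r (t₂ + 1)))
      (Gp := Hits G (r (t₂ + 1))) (y := fresh k (r (t₂ + 1))) (Nat.succ_pos j)
      (Nat.succ_le_of_lt j.2) (h3 ▸ hj) (hR _ (by omega)) h8
    rw [hw1] at hraw
    have := hg₂ v e f1 ⟨r (t₂ + 1), by rw [hraw]; exact ⟨w1, by simp⟩⟩ h2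
    omega

theorem Wf.length_le (hP : Wf k P) {v : List Entry} (hv : IsNode P v) :
    v.length ≤ bound S k := by
  have hnodup : (v.map Prod.snd).Nodup := by
    induction v using List.reverseRecOn with
    | nil => simp
    | append_singleton v e ih =>
      rw [List.map_append, List.nodup_append]
      refine ⟨ih (hv.of_prefix ⟨[e], rfl⟩), by simp, ?_⟩
      intro x hx y hy hxy
      obtain ⟨f, hf, rfl⟩ := List.mem_map.1 hx
      obtain rfl : y = e.2 := by simpa using hy
      exact hP.forest.notMem hv f hf hxy
  have hsub : (v.map Prod.snd).toFinset ⊆ Finset.range (bound S k) := by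
    intro x hx
    simp only [List.mem_toFinset, List.mem_map] at hx
    obtain ⟨e, he, rfl⟩ := hx
    exact Finset.mem_range.2 (hP.lt _ (hv.alive he))
  have := Finset.card_le_card hsub
  rwa [List.toFinset_card_of_nodup hnodup, List.length_map, Finset.card_range] at this

theorem key_cons_le {v u u' : List Entry} {e e' : Entry}
    (h : key (v ++ e' :: u') ≤ key (v ++ e :: u)) : e'.1 < e.1 ∨ (e'.1 = e.1 ∧ e'.2 ≤ e.2) := by
  rw [← Prod.Lex.toLex_le_toLex]
  by_contra hlt
  rw [not_le] at hlt
  refine not_lt.mpr h ?_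
  simp only [key, List.map_append, List.map_cons]
  exact List.Lex.append_left _ (List.Lex.rel hlt) _

/-- Progress of a run below a stable node `v`. -/
theorem step_progress (hP : Wf k P) {p q : S} (hpq : q ∈ δ p a) {v u : List Entry}
    (hp : P p = v ++ u) (hp0 : P p ≠ []) (hq : v <+: step δ R G P a q)
    (hv : ∀ e ∈ v, ¬ Bad (prune (raw δ R G P a)) e.2 ∧ ¬ Green (raw δ R G P a) e.2 ∧
      ¬ Hits R q e.1 ∧ ¬ Hits G q e.1) :
    ∃ i y w, step δ R G P a q =
        v ++ (i, open Classical in Nat.count (Alive (prune (raw δ R G P a))) y) :: w ∧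
      Alive (prune (raw δ R G P a)) y ∧
      ∀ e u', u = e :: u' → i ≤ e.1 ∧ (Hits R q e.1 → i < e.1) ∧
        (¬ Hits G q e.1 → i = e.1 → y ≤ e.2) := by
  classical
  have hforest := isForest_raw (δ := δ) (R := R) (G := G) (a := a) hP.forest hP.lt
  obtain ⟨p', hp', hraw⟩ := exists_raw_eq (R := R) (G := G) (q := q) ⟨p, hp0, hpq⟩
  have hmin := hp'.2 p ⟨hp0, hpq⟩
  rw [← hraw, inherit, hp, extend_append _ _ _ fun e he => (hv e he).2.2] at hmin
  have hq' := prefix_of_prefix_rename hq fun e he => (hv e he).1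
  obtain ⟨w, hw⟩ := hq'.trans (cut_prefix _ _)
  have hne : w ≠ [] := by
    rintro rfl
    rw [List.append_nil] at hw
    rcases List.eq_nil_or_concat v with rfl | ⟨v0, e, hv0⟩
    · rw [← hw] at hraw
      exact extend_ne_nil hp'.1.1 hraw.symm
    · rw [List.concat_eq_append] at hv0
      have helt := hP.lt e.2 ⟨p, e, by rw [hp, hv0]; simp, rfl⟩
      obtain ⟨v1, s, -, hs, hcase⟩ := inherit_spec (R := R) (G := G) hP.forest q p'
      rw [← hraw, ← hw] at hs
      rcases hcase with ⟨rfl, hfull⟩ | ⟨j, rfl, -⟩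
      · rw [List.append_nil] at hs
        subst hs
        have hng := (hv e (by simp [hv0])).2.1
        unfold Green at hng
        push Not at hng
        obtain ⟨v2, e2, f, hn, he2, hf⟩ := hng
        have h1 : IsNode (raw δ R G P a) (v2 ++ [e2]) := hn.of_prefix ⟨[f], by simp⟩
        obtain ⟨rfl, rfl⟩ := hforest.tree _ _ _ _ h1 ⟨q, by rw [← hw, hv0]⟩ he2
        have h2 := hforest.valid v f (by rw [hv0]; simpa using hn)
        have h3 := le_nextIdx (fun h => hf (h2.2 h)) (Nat.lt_succ_of_le h2.1)
        simp only [Nat.succ_eq_add_one] at h3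
        omega
      · have h1 := (List.append_inj' (hv0.symm.trans hs) rfl).2
        obtain rfl : e = _ := by simpa using h1
        have := bound_le_fresh (k := k) q
        simp only at helt
        omega
  obtain ⟨g, w', rfl⟩ := List.exists_cons_of_ne_nil hne
  have hprune : ∃ w'', prune (raw δ R G P a) q = v ++ g :: w'' := by
    unfold prune
    rw [← hw, cut_append _ _ fun e he => (hv e he).2.1, cut]
    split_ifs
    · exact ⟨_, rfl⟩
    · exact ⟨_, rfl⟩
  obtain ⟨w'', hw''⟩ := hprune
  have hvmap : v.map (fun e => (e.1, Nat.count (Alive (prune (raw δ R G P a))) e.2)) = v := by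
    conv_rhs => rw [← List.map_id v]
    exact List.map_congr_left fun e he => Prod.ext rfl (count_of_not_bad (hv e he).1)
  refine ⟨g.1, g.2, w''.map fun e => (e.1, Nat.count (Alive (prune (raw δ R G P a))) e.2), ?_,
    ⟨q, g, by rw [hw'']; simp, rfl⟩, ?_⟩
  · conv_rhs => rw [← hvmap]
    unfold step rename
    rw [hw'', List.map_append, List.map_cons]
  · rintro e u' rfl
    rw [← hw, extend] at hmin
    split_ifs at hmin with hR hG
    · have h0 : e.1 ≠ 0 := fun h => not_hits_zero R q (h ▸ hR)
      have h1 := nextIdx_le (usedFrom {0} v) e.1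
      have h2 := key_cons_le hmin
      simp only at h2
      exact ⟨by omega, fun _ => by omega, fun _ _ => by omega⟩
    · have h2 := key_cons_le hmin
      simp only at h2
      exact ⟨by omega, fun h => absurd h hR, fun h => absurd hG h⟩
    · have h2 := key_cons_le hmin
      exact ⟨by omega, fun h => absurd h hR, fun _ h => by omega⟩

theorem green_of_mem_language {w : ℕ → A} {s0 : S} {P : ℕ → S → List Entry}
    (h0 : P 0 = initial s0) (hs : ∀ t, P (t + 1) = step δ R G (P t) (w t))
    (hwf : ∀ t, Wf k (P t)) (hw : w ∈ StreettLang δ s0 R G) :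
    ∃ x < bound S k, (∃ T, ∀ t, T ≤ t → ¬ Bad (prune (raw δ R G (P t) (w t))) x) ∧
      ∀ N, ∃ t, N ≤ t ∧ Green (raw δ R G (P t) (w t)) x := by
  classical
  obtain ⟨r, ⟨hr0, hr⟩, hacc⟩ := hw
  by_contra! hcon
  have hlive : ∀ t, P t (r t) ≠ [] := by
    intro t
    induction t with
    | zero => simp [h0, initial, hr0]
    | succ t ih =>
      rw [hs]
      exact step_ne_nil ⟨ih, hr t⟩
  have hfair : ∀ i T, (∀ t, T ≤ t → ¬ Hits R (r t) i) → ∃ N, ∀ t, N ≤ t → ¬ Hits G (r t) i := by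
    intro i T hT
    by_contra! hG
    obtain ⟨-, -, j, rfl, -⟩ := hG 0
    rcases hacc j with h | h
    · obtain ⟨N, hN⟩ := (infOcc_inter_eq_empty_iff _ _).1 h
      obtain ⟨t, ht, j', hj', hmem⟩ := hG N
      obtain rfl : j = j' := Fin.ext (by omega)
      exact hN t ht hmem
    · obtain ⟨t, ht, hmem⟩ := (infOcc_inter_nonempty_iff _ _).1 h T
      exact hT t ht ⟨j, rfl, hmem⟩
  have hstable : ∀ d, ∃ v : List Entry, v.length = d ∧ ∃ T, ∀ t, T ≤ t → v <+: P t (r t) ∧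
      ∀ e ∈ v, ¬ Bad (prune (raw δ R G (P t) (w t))) e.2 ∧
        ¬ Green (raw δ R G (P t) (w t)) e.2 ∧
        ¬ Hits R (r (t + 1)) e.1 ∧ ¬ Hits G (r (t + 1)) e.1 := by
    intro d
    induction d with
    | zero => exact ⟨[], rfl, 0, by simp⟩
    | succ d ih =>
      obtain ⟨v, hv, T, hT⟩ := ih
      have hprog := fun t (ht : T ≤ t) u (hu : P t (r t) = v ++ u) =>
        step_progress (R := R) (G := G) (hwf t) (hr t) hu (hlive t)
          (by rw [← hs]; exact (hT (t + 1) (by omega)).1) (hT t ht).2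
      have hhead : ∀ t, T < t → ∃ i y u, P t (r t) = v ++ (i, y) :: u := by
        intro t ht
        obtain ⟨t, rfl⟩ : ∃ t', t = t' + 1 := ⟨t - 1, by omega⟩
        obtain ⟨u, hu⟩ := (hT t (by omega)).1
        obtain ⟨i, y, u', h, -⟩ := hprog t (by omega) u hu.symm
        exact ⟨i, _, u', by rw [hs, h]⟩
      choose! I Y U hIY using hhead
      have hnext : ∀ t, T < t → I (t + 1) ≤ I t ∧ (Hits R (r (t + 1)) (I t) → I (t + 1) < I t) ∧
          ∃ y, Y (t + 1) = Nat.count (Alive (prune (raw δ R G (P t) (w t)))) y ∧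
            Alive (prune (raw δ R G (P t) (w t))) y ∧
            (¬ Hits G (r (t + 1)) (I t) → I (t + 1) = I t → y ≤ Y t) := by
        intro t ht
        obtain ⟨i, y, u, h1, h2, h3⟩ := hprog t ht.le _ (hIY t ht)
        have h4 := hIY (t + 1) (by omega)
        rw [hs, h1] at h4
        have h5 := (List.cons.inj (List.append_cancel_left h4)).1
        obtain ⟨h6, h7⟩ := Prod.mk.inj h5
        obtain ⟨h8, h9, h10⟩ := h3 _ _ rfl
        rw [← h6]
        exact ⟨h8, h9, y, h7.symm, h2, h10⟩
      obtain ⟨T₁, hT₁, hI⟩ := exists_eventually_const I (T + 1) fun t ht => (hnext t ht).1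
      have hR : ∀ t, T₁ + 1 ≤ t → ¬ Hits R (r t) (I T₁) := by
        intro t ht hhit
        obtain ⟨t, rfl⟩ : ∃ t', t = t' + 1 := ⟨t - 1, by omega⟩
        have h1 := hI t (by omega)
        have h2 := hI (t + 1) (by omega)
        have h3 := (hnext t (by omega)).2.1 (h1 ▸ hhit)
        omega
      obtain ⟨T₂, hG⟩ := hfair _ _ hR
      have hnext' : ∀ t, max T₁ T₂ ≤ t →
          ∃ y, Y (t + 1) = Nat.count (Alive (prune (raw δ R G (P t) (w t)))) y ∧
            Alive (prune (raw δ R G (P t) (w t))) y ∧ y ≤ Y t := by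
        intro t ht
        obtain ⟨-, -, y, h1, h2, h3⟩ := hnext t (by omega)
        have h4 := hI t (by omega)
        have h5 := hI (t + 1) (by omega)
        exact ⟨y, h1, h2, h3 (by rw [h4]; exact hG _ (by omega)) (by omega)⟩
      obtain ⟨T₃, hT₃, hY⟩ := exists_eventually_const Y (max T₁ T₂) fun t ht => by
        obtain ⟨y, h1, -, h2⟩ := hnext' t ht
        rw [h1]
        exact (Nat.count_le _).trans h2
      have hbad : ∀ t, T₃ ≤ t → ¬ Bad (prune (raw δ R G (P t) (w t))) (Y T₃) := by
        intro t ht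
        obtain ⟨y, h1, h2, h3⟩ := hnext' t (by omega)
        have h4 := hY t (by omega)
        have h5 := hY (t + 1) (by omega)
        have h6 := Nat.count_le (Alive (prune (raw δ R G (P t) (w t)))) (n := y)
        obtain rfl : y = Y T₃ := by omega
        exact not_bad_of_count h2 (by omega)
      have hlt : Y T₃ < bound S k :=
        (hwf T₃).lt _ ⟨r T₃, (I T₃, Y T₃), by rw [hIY T₃ (by omega)]; simp, rfl⟩
      obtain ⟨T₄, hT₄⟩ := hcon (Y T₃) hlt ⟨T₃, hbad⟩
      refine ⟨v ++ [(I T₁, Y T₃)], by simp [hv], max T₃ T₄, fun t ht => ⟨?_, ?_⟩⟩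
      · rw [hIY t (by omega), hI t (by omega), hY t (by omega)]
        exact ⟨U t, by simp⟩
      · intro e he
        rcases List.mem_append.1 he with he | he
        · exact (hT t (by omega)).2 e he
        · rw [List.mem_singleton.1 he]
          exact ⟨hbad t (by omega), hT₄ t (by omega), hR _ (by omega), hG _ (by omega)⟩
  obtain ⟨v, hv, T, hT⟩ := hstable (bound S k + 1)
  have := (hwf T).length_le ⟨r T, (hT T le_rfl).1⟩
  omega

end Correctness

section Automaton

variable [Fintype S]

/-- The states of the deterministic automaton: a tree, with its unstable and its green names. -/
abbrev DetState (S : Type) [Fintype S] (k : ℕ) : Type :=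
  {P : S → List Entry // Wf k P} × Set (Fin (bound S k)) × Set (Fin (bound S k))

/-- The transition function of the deterministic automaton. -/
noncomputable def detStep (δ : S → A → Set S) (R G : Fin k → Set S) (t : DetState S k) (a : A) :
    DetState S k :=
  (⟨step δ R G t.1.1 a, t.1.2.step⟩, {x | Bad (prune (raw δ R G t.1.1 a)) x},
    {x | Green (raw δ R G t.1.1 a) x})

/-- The initial state of the deterministic automaton. -/
noncomputable def detInit (k : ℕ) (s0 : S) : DetState S k := (⟨initial s0, wf_initial s0⟩, ∅, ∅)

theorem rabinAccept_iff (δ : S → A → Set S) (R G : Fin k → Set S) (s0 : S) (w : ℕ → A) :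
    RabinAccept (fun x : Fin (bound S k) => {t : DetState S k | x ∈ t.2.1})
      (fun x => {t | x ∈ t.2.2}) (DetRun (detStep δ R G) (detInit k s0) w) ↔
    w ∈ StreettLang δ s0 R G := by
  set run := DetRun (detStep δ R G) (detInit k s0) w with hrun
  have hs : ∀ t, run (t + 1) = detStep δ R G (run t) (w t) := fun t => rfl
  have : Finite (DetState S k) := inferInstance
  unfold RabinAccept
  simp only [infOcc_inter_eq_empty_iff, infOcc_inter_nonempty_iff]
  constructor
  · rintro ⟨x, ⟨T, hT⟩, hg⟩
    refine mem_language_of_green (P := fun t => (run t).1.1) rfl (fun t => rfl)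
      (fun t => (run t).1.2) x.2 (T := T) (fun t ht => hT (t + 1) (by omega)) fun N => ?_
    obtain ⟨t, ht, hx⟩ := hg (N + 1)
    obtain ⟨t, rfl⟩ : ∃ t', t = t' + 1 := ⟨t - 1, by omega⟩
    exact ⟨t, by omega, hx⟩
  · intro hw
    obtain ⟨x, hx, ⟨T, hT⟩, hg⟩ := green_of_mem_language (P := fun t => (run t).1.1) rfl
      (fun t => rfl) (fun t => (run t).1.2) hw
    refine ⟨⟨x, hx⟩, ⟨T + 1, fun t ht => ?_⟩, fun N => ?_⟩
    · obtain ⟨t, rfl⟩ : ∃ t', t = t' + 1 := ⟨t - 1, by omega⟩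
      exact hT t (by omega)
    · obtain ⟨t, ht, hx⟩ := hg N
      exact ⟨t + 1, by omega, hx⟩

end Automaton

end StreettTree


/-- For every nondeterministic Streett word automaton `S` with
`n ≥ 1` states and `k` pairs there exists a deterministic Rabin word automaton
`D` with at most `12^{n(k+1)}·n^n·(k+1)^{n(k+1)}·(n(k+1))^{n(k+1)}` states and
`n(k+1)` pairs such that `L(D) = L(S)`. -/
theorem nsw_to_drw (A : Type) [Fintype A] (S : Type) [Fintype S] (n k : ℕ)
    (hn : 1 ≤ n) (hcard : Fintype.card S = n)
    (δ : S → A → Set S) (s0 : S) (R G : Fin k → Set S) :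
    ∃ (T : Type) (instT : Fintype T) (δ' : T → A → T) (t0 : T)
      (E F : Fin (n * (k + 1)) → Set T),
      @Fintype.card T instT ≤
        12 ^ (n * (k + 1)) * n ^ n * (k + 1) ^ (n * (k + 1)) *
          (n * (k + 1)) ^ (n * (k + 1)) ∧
      {w : ℕ → A | RabinAccept E F (DetRun δ' t0 w)} = StreettLang δ s0 R G := by
  classical
  subst hcard
  refine ⟨StreettTree.DetState S k, inferInstance, StreettTree.detStep δ R G,
    StreettTree.detInit k s0, fun x => {t | x ∈ t.2.1}, fun x => {t | x ∈ t.2.2}, ?_, ?_⟩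
  · refine le_trans ?_ (StreettTree.state_count_le _ k hn)
    simpa using Nat.mul_le_mul_right (2 ^ (Fintype.card S * (k + 1)) * 2 ^ (Fintype.card S * (k + 1)))
      (StreettTree.card_wf_le (S := S) (k := k))
  · ext w
    exact StreettTree.rabinAccept_iff δ R G s0 w
end

section
/- For every finite set S with |S| = n ≥ 1, the number of Safra trees over S is at most 12^n·n^{2n}. -/
/-- A *Safra tree* over a state set `S` with `|S| = n`.  Node names are taken
from `V = Fin n` (representing `[n] = {1,…,n}`).  The parent function, which is
defined on `N - {root}`, is encoded as a total function that is the identity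
outside of its domain, and the labeling, defined on `N`, is encoded as a total
function that is empty outside of `N`. -/
structure SafraTree (S : Type) (n : ℕ) where
  /-- the set of nodes `N ⊆ V` -/
  nodes : Finset (Fin n)
  /-- the root node `r ∈ N` -/
  root : Fin n
  root_mem : root ∈ nodes
  /-- the parent function `p`, defined over `N - {root}` -/
  parent : Fin n → Fin n
  parent_id : ∀ v : Fin n, v ∉ nodes ∨ v = root → parent v = v
  parent_mem : ∀ v ∈ nodes, v ≠ root → parent v ∈ nodes
  /-- `N` is a rooted tree: iterating the parent function reaches the root -/
  reaches_root : ∀ v ∈ nodes, ∃ m : ℕ, parent^[m] v = root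
  /-- `ψ`, the strict "older than" order on every set of siblings -/
  older : Fin n → Fin n → Prop
  older_sib : ∀ v u, older v u →
    v ∈ nodes ∧ u ∈ nodes ∧ v ≠ root ∧ u ≠ root ∧ v ≠ u ∧ parent v = parent u
  older_total : ∀ v ∈ nodes, ∀ u ∈ nodes, v ≠ root → u ≠ root → v ≠ u →
    parent v = parent u → older v u ∨ older u v
  older_asymm : ∀ v u, older v u → ¬ older u v
  older_trans : ∀ v u x, older v u → older u x → older v x
  /-- the labeling `l : N → 2^S` -/
  label : Fin n → Set S
  label_empty : ∀ v : Fin n, v ∉ nodes → label v = ∅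
  /-- the label of every node is a proper superset of the union of the labels
  of its sons -/
  label_proper : ∀ v ∈ nodes,
    {s | ∃ u, u ∈ nodes ∧ u ≠ root ∧ parent u = v ∧ s ∈ label u} ⊂ label v
  /-- the labels of two siblings are disjoint -/
  label_disj : ∀ v ∈ nodes, ∀ u ∈ nodes, v ≠ root → u ≠ root → v ≠ u →
    parent v = parent u → label v ∩ label u = ∅
  /-- the set `E ⊆ V` -/
  Eset : Set (Fin n)
  /-- the set `F ⊆ V` -/
  Fset : Set (Fin n)
  EF_disj : Eset ∩ Fset = ∅

namespace SafraTree

variable {S : Type} {n : ℕ}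

/-- The states in the label of `v` that occur in no label of a son of `v`. -/
def own (T : SafraTree S n) (v : Fin n) : Set S :=
  T.label v \ {s | ∃ u, u ∈ T.nodes ∧ u ≠ T.root ∧ T.parent u = v ∧ s ∈ T.label u}

theorem mem_nodes_of_mem_label (T : SafraTree S n) {v : Fin n} {s : S} (h : s ∈ T.label v) :
    v ∈ T.nodes := by
  by_contra hv
  simp [T.label_empty v hv] at h

theorem mem_label_parent (T : SafraTree S n) {v : Fin n} {s : S} (h : s ∈ T.label v) :
    s ∈ T.label (T.parent v) := by
  have hv := T.mem_nodes_of_mem_label h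
  by_cases hr : v = T.root
  · rwa [T.parent_id v (Or.inr hr)]
  · exact (T.label_proper _ (T.parent_mem v hv hr)).1 ⟨v, hv, hr, rfl, h⟩

theorem mem_label_iterate_parent (T : SafraTree S n) {v : Fin n} {s : S} (h : s ∈ T.label v)
    (m : ℕ) : s ∈ T.label (T.parent^[m] v) := by
  induction m with
  | zero => exact h
  | succ m ih =>
    rw [Function.iterate_succ_apply']
    exact T.mem_label_parent ih

/-- A node that owns `s` is not a proper ancestor of a node whose label contains `s`. -/
theorem eq_of_iterate_parent_eq (T : SafraTree S n) {v w : Fin n} {s : S} (hv : s ∈ T.label v)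
    (hw : s ∈ T.own w) {m : ℕ} (h : T.parent^[m] v = w) : v = w := by
  induction m with
  | zero => exact h
  | succ m ih =>
    rw [Function.iterate_succ_apply'] at h
    have hu := T.mem_label_iterate_parent hv m
    by_cases hr : T.parent^[m] v = T.root
    · rw [T.parent_id _ (Or.inr hr)] at h
      exact ih h
    · exact absurd ⟨_, T.mem_nodes_of_mem_label hu, hr, h, hu⟩ hw.2

/-- Every node whose label contains `s` is an ancestor of a node that owns `s`. -/
theorem exists_iterate_parent_eq (T : SafraTree S n) {v w : Fin n} {s : S} (hv : s ∈ T.own v)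
    (hw : s ∈ T.label w) : ∃ m, T.parent^[m] v = w := by
  obtain ⟨k, hk⟩ := T.reaches_root w (T.mem_nodes_of_mem_label hw)
  induction k generalizing w with
  | zero =>
    obtain ⟨m, hm⟩ := T.reaches_root v (T.mem_nodes_of_mem_label hv.1)
    exact ⟨m, hm.trans hk.symm⟩
  | succ k ih =>
    by_cases hr : w = T.root
    · rw [hr]
      exact T.reaches_root v (T.mem_nodes_of_mem_label hv.1)
    obtain ⟨j, hj⟩ := ih (T.mem_label_parent hw) hk
    have hwn := T.mem_nodes_of_mem_label hw
    induction j with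
    | zero => exact absurd ⟨w, hwn, hr, hj.symm, hw⟩ hv.2
    | succ j ihj =>
      rw [Function.iterate_succ_apply'] at hj
      have hu := T.mem_label_iterate_parent hv.1 j
      by_cases hur : T.parent^[j] v = T.root
      · rw [T.parent_id _ (Or.inr hur)] at hj
        exact ihj hj
      · refine ⟨j, ?_⟩
        by_contra hne
        have := T.label_disj _ (T.mem_nodes_of_mem_label hu) w hwn hur hr hne hj
        exact Set.notMem_empty s (this ▸ ⟨hu, hw⟩)

theorem exists_mem_own [Finite S] (T : SafraTree S n) {v : Fin n} {s : S} (h : s ∈ T.label v) :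
    ∃ w, s ∈ T.own w := by
  induction hA : T.label v using (wellFounded_lt (α := Set S)).induction generalizing v with
  | _ A ih =>
    subst hA
    by_cases hs : s ∈ T.own v
    · exact ⟨v, hs⟩
    · obtain ⟨u, hu, hr, hp, hsu⟩ : ∃ u, u ∈ T.nodes ∧ u ≠ T.root ∧ T.parent u = v ∧
          s ∈ T.label u := by
        by_contra hc
        exact hs ⟨h, hc⟩
      refine ih _ (lt_of_le_of_lt ?_ (T.label_proper v (T.mem_nodes_of_mem_label h))) hsu rfl
      exact fun t ht => ⟨u, hu, hr, hp, ht⟩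

theorem own_nonempty (T : SafraTree S n) {v : Fin n} (hv : v ∈ T.nodes) : (T.own v).Nonempty := by
  obtain ⟨s, hs, hs'⟩ := Set.exists_of_ssubset (T.label_proper v hv)
  exact ⟨s, hs, hs'⟩

theorem exists_mem_own_of_nodes_eq_univ [Fintype S] (hcard : Fintype.card S = n)
    (T : SafraTree S n) (hN : ∀ v, v ∈ T.nodes) (s : S) : ∃ w, s ∈ T.own w := by
  choose f hf using fun v => T.own_nonempty (hN v)
  have hinj : Function.Injective f := by
    intro v w h
    have hv := hf v
    rw [h] at hv
    obtain ⟨m, hm⟩ := T.exists_iterate_parent_eq hv (hf w).1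
    exact T.eq_of_iterate_parent_eq hv.1 (hf w) hm
  have hbij := (Fintype.bijective_iff_injective_and_card f).2 ⟨hinj, by simp [hcard]⟩
  obtain ⟨w, rfl⟩ := hbij.2 s
  exact ⟨w, hf w⟩

/-- The labeling is determined by the tree and a map sending each state to a node that owns it, or
outside of the tree if there is none. -/
theorem exists_owner [Fintype S] (hcard : Fintype.card S = n) (T : SafraTree S n) :
    ∃ g : S → Fin n, ∀ s w, s ∈ T.label w ↔
      g s ∈ T.nodes ∧ w ∈ T.nodes ∧ ∃ m, T.parent^[m] (g s) = w := by
  suffices ∀ s, ∃ v, ∀ w, s ∈ T.label w ↔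
      v ∈ T.nodes ∧ w ∈ T.nodes ∧ ∃ m, T.parent^[m] v = w by
    choose g hg using this
    exact ⟨g, hg⟩
  intro s
  by_cases hs : ∃ v, s ∈ T.own v
  · obtain ⟨v, hv⟩ := hs
    refine ⟨v, fun w => ⟨fun hw => ⟨T.mem_nodes_of_mem_label hv.1, T.mem_nodes_of_mem_label hw,
      T.exists_iterate_parent_eq hv hw⟩, ?_⟩⟩
    rintro ⟨-, -, m, rfl⟩
    exact T.mem_label_iterate_parent hv.1 m
  · obtain ⟨v, hv⟩ : ∃ v, v ∉ T.nodes := by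
      by_contra! hN
      exact hs (T.exists_mem_own_of_nodes_eq_univ hcard hN s)
    exact ⟨v, fun w => ⟨fun hw => absurd (T.exists_mem_own hw) hs, fun h => absurd h.1 hv⟩⟩

open Classical in
/-- The parent of a nonroot node, with special values at the root and outside of the tree. -/
noncomputable def key (T : SafraTree S n) (v : Fin n) : Fin (n + 2) :=
  if v ∉ T.nodes then ⟨n + 1, by omega⟩ else if v = T.root then ⟨n, by omega⟩
    else ⟨T.parent v, by omega⟩

theorem key_of_notMem (T : SafraTree S n) {v : Fin n} (h : v ∉ T.nodes) :
    (T.key v : ℕ) = n + 1 := by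
  simp [key, h]

theorem key_root (T : SafraTree S n) : (T.key T.root : ℕ) = n := by
  simp [key, T.root_mem]

theorem key_of_ne_root (T : SafraTree S n) {v : Fin n} (h : v ∈ T.nodes) (hr : v ≠ T.root) :
    (T.key v : ℕ) = T.parent v := by
  simp [key, h, hr]

theorem mem_nodes_iff (T : SafraTree S n) (v : Fin n) : v ∈ T.nodes ↔ (T.key v : ℕ) ≠ n + 1 := by
  by_cases h : v ∈ T.nodes
  · by_cases hr : v = T.root
    · subst hr
      simp [h, T.key_root]
    · have := T.key_of_ne_root h hr
      simp only [h, true_iff]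
      omega
  · simp [h, T.key_of_notMem h]

theorem eq_root_iff (T : SafraTree S n) (v : Fin n) : v = T.root ↔ (T.key v : ℕ) = n := by
  by_cases h : v ∈ T.nodes
  · by_cases hr : v = T.root
    · subst hr
      simp [T.key_root]
    · have := T.key_of_ne_root h hr
      simp only [hr, false_iff]
      omega
  · have : v ≠ T.root := fun hv => h (hv ▸ T.root_mem)
    simp [this, T.key_of_notMem h]

/-- A strict total order on `Fin n` that refines the preorder given by `key` and extends the order
of the siblings. -/
def before (T : SafraTree S n) (v u : Fin n) : Prop :=
  T.key v < T.key u ∨ T.key v = T.key u ∧ (T.older v u ∨ v ∉ T.nodes ∧ v < u)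

theorem before_irrefl (T : SafraTree S n) (v : Fin n) : ¬ T.before v v := by
  rintro (h | ⟨-, h | h⟩)
  · exact lt_irrefl _ h
  · exact T.older_asymm v v h h
  · exact lt_irrefl _ h.2

theorem before_trans (T : SafraTree S n) {v u x : Fin n} (h₁ : T.before v u)
    (h₂ : T.before u x) : T.before v x := by
  rcases h₁ with h₁ | ⟨e₁, h₁⟩ <;> rcases h₂ with h₂ | ⟨e₂, h₂⟩
  · exact Or.inl (h₁.trans h₂)
  · exact Or.inl (e₂ ▸ h₁)
  · exact Or.inl (e₁ ▸ h₂)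
  · refine Or.inr ⟨e₁.trans e₂, ?_⟩
    rcases h₁ with h₁ | h₁ <;> rcases h₂ with h₂ | h₂
    · exact Or.inl (T.older_trans v u x h₁ h₂)
    · exact absurd (T.older_sib v u h₁).2.1 h₂.1
    · have hu := (T.older_sib u x h₂).1
      rw [mem_nodes_iff, ← e₁, ← mem_nodes_iff] at hu
      exact absurd hu h₁.1
    · exact Or.inr ⟨h₁.1, h₁.2.trans h₂.2⟩

theorem before_total (T : SafraTree S n) {v u : Fin n} (h : v ≠ u) :
    T.before v u ∨ T.before u v := by
  rcases lt_trichotomy (T.key v) (T.key u) with hk | hk | hk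
  · exact Or.inl (Or.inl hk)
  · by_cases hv : v ∈ T.nodes
    · have hu := hv
      rw [mem_nodes_iff, hk, ← mem_nodes_iff] at hu
      have hvr : v ≠ T.root := by
        intro hr
        have hur := hr
        rw [eq_root_iff, hk, ← eq_root_iff] at hur
        exact h (hr.trans hur.symm)
      have hur : u ≠ T.root := by
        rwa [Ne, eq_root_iff, ← hk, ← eq_root_iff]
      have hp : T.parent v = T.parent u := by
        rw [Fin.ext_iff, ← T.key_of_ne_root hv hvr, ← T.key_of_ne_root hu hur, hk]
      rcases T.older_total v hv u hu hvr hur h hp with ho | ho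
      · exact Or.inl (Or.inr ⟨hk, Or.inl ho⟩)
      · exact Or.inr (Or.inr ⟨hk.symm, Or.inl ho⟩)
    · have hu := hv
      rw [mem_nodes_iff, hk, ← mem_nodes_iff] at hu
      rcases lt_or_gt_of_ne h with hl | hl
      · exact Or.inl (Or.inr ⟨hk, Or.inr ⟨hv, hl⟩⟩)
      · exact Or.inr (Or.inr ⟨hk.symm, Or.inr ⟨hu, hl⟩⟩)
  · exact Or.inr (Or.inl hk)

open Classical in
/-- The position of `v` in the order `before`. -/
noncomputable def rank (T : SafraTree S n) (v : Fin n) : Fin n :=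
  ⟨(Finset.univ.filter fun u => T.before u v).card, by
    have : (Finset.univ.filter fun u => T.before u v) ⊂ Finset.univ :=
      Finset.filter_ssubset.2 ⟨v, Finset.mem_univ v, T.before_irrefl v⟩
    simpa using Finset.card_lt_card this⟩

theorem rank_lt_rank (T : SafraTree S n) {v u : Fin n} (h : T.before v u) :
    T.rank v < T.rank u := by
  rw [rank, rank, Fin.mk_lt_mk]
  refine Finset.card_lt_card (Finset.ssubset_iff_of_subset ?_ |>.2 ⟨v, ?_, ?_⟩)
  · intro x hx
    simp only [Finset.mem_filter, Finset.mem_univ, true_and] at hx ⊢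
    exact T.before_trans hx h
  · simpa using h
  · simpa using T.before_irrefl v

theorem rank_lt_rank_iff (T : SafraTree S n) {v u : Fin n} :
    T.rank v < T.rank u ↔ T.before v u := by
  refine ⟨fun h => ?_, T.rank_lt_rank⟩
  have hne : v ≠ u := by
    rintro rfl
    exact lt_irrefl _ h
  exact (T.before_total hne).resolve_right fun hb => lt_asymm h (T.rank_lt_rank hb)

theorem rank_injective (T : SafraTree S n) : Function.Injective T.rank := by
  intro v u h
  by_contra hne
  rcases T.before_total hne with hb | hb
  · exact (T.rank_lt_rank hb).ne h
  · exact (T.rank_lt_rank hb).ne' h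

theorem key_le_of_rank_lt (T : SafraTree S n) {v u : Fin n} (h : T.rank v < T.rank u) :
    T.key v ≤ T.key u := by
  rcases T.rank_lt_rank_iff.1 h with hb | hb
  · exact hb.le
  · exact hb.1.le

theorem older_iff (T : SafraTree S n) (v u : Fin n) :
    T.older v u ↔ T.key v = T.key u ∧ v ∈ T.nodes ∧ T.rank v < T.rank u := by
  rw [rank_lt_rank_iff]
  constructor
  · intro h
    obtain ⟨hv, hu, hvr, hur, -, hp⟩ := T.older_sib v u h
    have hk : T.key v = T.key u := by
      rw [Fin.ext_iff, T.key_of_ne_root hv hvr, T.key_of_ne_root hu hur, hp]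
    exact ⟨hk, hv, Or.inr ⟨hk, Or.inl h⟩⟩
  · rintro ⟨hk, hv, hb | ⟨-, hb | hb⟩⟩
    · exact absurd hk hb.ne
    · exact hb
    · exact absurd hv hb.1

end SafraTree

/-- Two functions that are monotone along the same linear order and take the same values with the
same multiplicities are equal. -/
theorem eq_of_map_univ_eq {ι α β : Type*} [Fintype ι] [LinearOrder α] [LinearOrder β]
    {r : ι → α} (hr : Function.Injective r) {f g : ι → β}
    (hf : ∀ i j, r i < r j → f i ≤ f j) (hg : ∀ i j, r i < r j → g i ≤ g j)
    (h : Finset.univ.val.map f = Finset.univ.val.map g) : f = g := by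
  have hcard (b : β) : (Finset.univ.filter fun i => f i < b).card =
      (Finset.univ.filter fun i => g i < b).card := by
    have := congrArg (Multiset.countP (· < b)) h
    simpa only [Multiset.countP_map, Finset.card_def, Finset.filter_val] using this
  have hmem (b : β) (i : ι) : f i < b ↔ g i < b := by
    have hsub : (Finset.univ.filter fun i => f i < b) = Finset.univ.filter fun i => g i < b := by
      by_cases hs : (Finset.univ.filter fun i => f i < b) ⊆ Finset.univ.filter fun i => g i < b
      · exact Finset.eq_of_subset_of_card_le hs (hcard b).ge
      · obtain ⟨i, hi, hi'⟩ := Finset.not_subset.1 hs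
        simp only [Finset.mem_filter, Finset.mem_univ, true_and, not_lt] at hi hi'
        refine (Finset.eq_of_subset_of_card_le ?_ (hcard b).le).symm
        intro j hj
        simp only [Finset.mem_filter, Finset.mem_univ, true_and] at hj ⊢
        have hji : r j < r i := by
          rcases lt_trichotomy (r j) (r i) with hlt | heq | hgt
          · exact hlt
          · exact absurd (hr heq ▸ hj) hi'.not_gt
          · exact absurd ((hi'.trans (hg i j hgt)).trans_lt hj) (lt_irrefl b)
        exact (hf j i hji).trans_lt hi
    simpa using congrArg (i ∈ ·) hsub
  funext i
  exact le_antisymm (not_lt.1 fun hlt => lt_irrefl _ ((hmem (f i) i).2 hlt))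
    (not_lt.1 fun hlt => lt_irrefl _ ((hmem (g i) i).1 hlt))

namespace SafraTree

variable {S : Type} {n : ℕ}

open Classical in
/-- The code of the disjoint sets `E` and `F`. -/
noncomputable def mark (T : SafraTree S n) (v : Fin n) : Fin 3 :=
  if v ∈ T.Eset then 0 else if v ∈ T.Fset then 1 else 2

theorem mem_Eset_iff (T : SafraTree S n) (v : Fin n) : v ∈ T.Eset ↔ T.mark v = 0 := by
  unfold mark
  split_ifs <;> simp [*]

theorem mem_Fset_iff (T : SafraTree S n) (v : Fin n) : v ∈ T.Fset ↔ T.mark v = 1 := by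
  have hd : v ∈ T.Eset → v ∉ T.Fset := fun hE hF => Set.notMem_empty v (T.EF_disj ▸ ⟨hE, hF⟩)
  unfold mark
  split_ifs with hE hF
  · simp [hd hE]
  · simp [hF]
  · simp [hF]

/-- A map sending each state to a node that owns it, as provided by `exists_owner`. -/
noncomputable def owner [Fintype S] (hcard : Fintype.card S = n) (T : SafraTree S n) :
    S → Fin n :=
  (T.exists_owner hcard).choose

theorem mem_label_iff [Fintype S] (hcard : Fintype.card S = n) (T : SafraTree S n) (s : S)
    (w : Fin n) : s ∈ T.label w ↔
      T.owner hcard s ∈ T.nodes ∧ w ∈ T.nodes ∧ ∃ m, T.parent^[m] (T.owner hcard s) = w :=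
  (T.exists_owner hcard).choose_spec s w

/-- The code of a Safra tree. -/
noncomputable def code [Fintype S] (hcard : Fintype.card S = n) (T : SafraTree S n) :
    (Fin n → Fin n) × Sym (Fin (n + 2)) n × (S → Fin n) × (Fin n → Fin 3) :=
  (T.rank, ⟨Finset.univ.val.map T.key, by simp⟩, T.owner hcard, T.mark)

theorem code_injective [Fintype S] (hcard : Fintype.card S = n) :
    Function.Injective (code (S := S) hcard) := by
  intro T U h
  have hrank : T.rank = U.rank := congrArg Prod.fst h
  have hmap : Finset.univ.val.map T.key = Finset.univ.val.map U.key :=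
    congrArg (fun c => c.2.1.1) h
  have howner : T.owner hcard = U.owner hcard := congrArg (fun c => c.2.2.1) h
  have hmark : T.mark = U.mark := congrArg (fun c => c.2.2.2) h
  have hkey : T.key = U.key := eq_of_map_univ_eq T.rank_injective
    (fun _ _ => T.key_le_of_rank_lt) (fun _ _ hr => U.key_le_of_rank_lt (hrank ▸ hr)) hmap
  have hnodes : T.nodes = U.nodes := by
    ext v
    rw [mem_nodes_iff, mem_nodes_iff, hkey]
  have hroot : T.root = U.root := by
    rw [eq_root_iff, ← hkey, T.key_root]
  have hparent : T.parent = U.parent := by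
    funext v
    by_cases hv : v ∈ T.nodes ∧ v ≠ T.root
    · rw [Fin.ext_iff, ← T.key_of_ne_root hv.1 hv.2, hkey,
        U.key_of_ne_root (hnodes ▸ hv.1) (hroot ▸ hv.2)]
    · have hv' : v ∉ T.nodes ∨ v = T.root := by tauto
      rw [T.parent_id v hv', U.parent_id v (hnodes ▸ hroot ▸ hv')]
  have holder : T.older = U.older := by
    funext v u
    rw [older_iff, older_iff, hkey, hnodes, hrank]
  have hlabel : T.label = U.label := by
    funext w
    ext s
    rw [T.mem_label_iff hcard, U.mem_label_iff hcard, hnodes, hparent, howner]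
  have hE : T.Eset = U.Eset := by
    ext v
    rw [mem_Eset_iff, mem_Eset_iff, hmark]
  have hF : T.Fset = U.Fset := by
    ext v
    rw [mem_Fset_iff, mem_Fset_iff, hmark]
  cases T
  cases U
  simp only at hnodes hroot hparent holder hlabel hE hF
  subst hnodes hroot hparent holder hlabel hE hF
  rfl

end SafraTree

/-- For every finite set `S` with `|S| = n ≥ 1`, the number of
Safra trees over `S` is at most `12^n·n^{2n}`. -/
theorem safraTree_count (S : Type) [Fintype S] (n : ℕ) (hn : 1 ≤ n)
    (hcard : Fintype.card S = n) :
    Nat.card (SafraTree S n) ≤ 12 ^ n * n ^ (2 * n) := by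
  classical
  have hsym : Nat.card (Sym (Fin (n + 2)) n) ≤ 4 ^ n := by
    rw [Nat.card_eq_fintype_card, Sym.card_sym_eq_choose, Fintype.card_fin,
      show n + 2 + n - 1 = 2 * n + 1 by omega]
    exact Nat.choose_middle_le_pow n
  calc Nat.card (SafraTree S n)
      ≤ n ^ n * (Nat.card (Sym (Fin (n + 2)) n) * (n ^ n * 3 ^ n)) := by
        have := Nat.card_le_card_of_injective _ (SafraTree.code_injective (S := S) hcard)
        simpa [Nat.card_prod, Nat.card_fun, hcard] using this
    _ ≤ n ^ n * (4 ^ n * (n ^ n * 3 ^ n)) := by gcongr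
    _ = 12 ^ n * n ^ (2 * n) := by
        rw [show (12 : ℕ) = 4 * 3 by norm_num, mul_pow, two_mul, pow_add]
        ring
end

section
/- For every finite set S with |S| = n ≥ 1 and every k ≥ 1, the number of Streett Safra trees over S with index k is at most 12^{n(k+1)}·n^n·(k+1)^{n(k+1)}·(n(k+1))^{n(k+1)}. -/
/-- A *Streett Safra tree* over a state set `S` with `|S| = n` and index `k`.
Node names are taken from `V = Fin (n*(k+1))` (representing `[m]` for
`m = n(k+1)`), and annotations are subsets of `Fin k` (representing
`[k] = {1,…,k}`).  The parent function, defined on `N - {root}`, is encoded as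
a total function that is the identity outside of its domain; the labeling and
the annotation, defined on `N`, are encoded as total functions that are empty
outside of `N`.  The requirement that the label of a node equals the union of
the labels of its sons applies to the nodes that have sons. -/
structure StreettSafraTree (S : Type) (n k : ℕ) where
  /-- the set of nodes `N ⊆ V` -/
  nodes : Finset (Fin (n * (k + 1)))
  /-- the root node `r ∈ N` -/
  root : Fin (n * (k + 1))
  root_mem : root ∈ nodes
  /-- the parent function `p`, defined over `N - {root}` -/
  parent : Fin (n * (k + 1)) → Fin (n * (k + 1))
  parent_id : ∀ v : Fin (n * (k + 1)), v ∉ nodes ∨ v = root → parent v = v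
  parent_mem : ∀ v ∈ nodes, v ≠ root → parent v ∈ nodes
  /-- `N` is a rooted tree: iterating the parent function reaches the root -/
  reaches_root : ∀ v ∈ nodes, ∃ m : ℕ, parent^[m] v = root
  /-- `ψ`, the strict "older than" order on every set of siblings -/
  older : Fin (n * (k + 1)) → Fin (n * (k + 1)) → Prop
  older_sib : ∀ v u, older v u →
    v ∈ nodes ∧ u ∈ nodes ∧ v ≠ root ∧ u ≠ root ∧ v ≠ u ∧ parent v = parent u
  older_total : ∀ v ∈ nodes, ∀ u ∈ nodes, v ≠ root → u ≠ root → v ≠ u →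
    parent v = parent u → older v u ∨ older u v
  older_asymm : ∀ v u, older v u → ¬ older u v
  older_trans : ∀ v u x, older v u → older u x → older v x
  /-- the labeling `l : N → 2^S` -/
  label : Fin (n * (k + 1)) → Set S
  label_empty : ∀ v : Fin (n * (k + 1)), v ∉ nodes → label v = ∅
  /-- every node has a nonempty label -/
  label_nonempty : ∀ v ∈ nodes, (label v).Nonempty
  /-- the label of every node (with sons) equals the union of the labels of its sons -/
  label_union : ∀ v ∈ nodes, (∃ u, u ∈ nodes ∧ u ≠ root ∧ parent u = v) →
    label v = {s | ∃ u, u ∈ nodes ∧ u ≠ root ∧ parent u = v ∧ s ∈ label u}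
  /-- the labels of two siblings are disjoint -/
  label_disj : ∀ v ∈ nodes, ∀ u ∈ nodes, v ≠ root → u ≠ root → v ≠ u →
    parent v = parent u → label v ∩ label u = ∅
  /-- the annotation `h : N → 2^{[k]}` -/
  ann : Fin (n * (k + 1)) → Set (Fin k)
  ann_empty : ∀ v : Fin (n * (k + 1)), v ∉ nodes → ann v = ∅
  /-- the root is annotated by `[k]` -/
  ann_root : ann root = Set.univ
  /-- the annotation of every node is contained in that of its parent -/
  ann_sub : ∀ v ∈ nodes, v ≠ root → ann v ⊆ ann (parent v)
  /-- the annotation of a node misses at most one element of the annotation of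
  its parent -/
  ann_miss : ∀ v ∈ nodes, v ≠ root → ∀ a b : Fin k,
    a ∈ ann (parent v) → a ∉ ann v → b ∈ ann (parent v) → b ∉ ann v → a = b
  /-- every node that is not a leaf has at least one son with strictly smaller
  annotation -/
  ann_strict : ∀ v ∈ nodes, (∃ u, u ∈ nodes ∧ u ≠ root ∧ parent u = v) →
    ∃ u, u ∈ nodes ∧ u ≠ root ∧ parent u = v ∧ ann u ⊂ ann v
  /-- the set `E ⊆ V` -/
  Eset : Set (Fin (n * (k + 1)))
  /-- the set `F ⊆ V` -/
  Fset : Set (Fin (n * (k + 1)))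
  EF_disj : Eset ∩ Fset = ∅

namespace StreettSafraTree

variable {S : Type} {n k : ℕ}

theorem ext_fields {T T' : StreettSafraTree S n k} (hN : T.nodes = T'.nodes)
    (hr : T.root = T'.root) (hp : T.parent = T'.parent) (ho : T.older = T'.older)
    (hl : T.label = T'.label) (ha : T.ann = T'.ann) (hE : T.Eset = T'.Eset)
    (hF : T.Fset = T'.Fset) : T = T' := by
  cases T
  cases T'
  simp only at hN hr hp ho hl ha hE hF
  subst hN hr hp ho hl ha hE hF
  rfl

/-- There is a depth function increasing strictly from parents to sons. -/
theorem exists_depth (T : StreettSafraTree S n k) :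
    ∃ d : Fin (n * (k + 1)) → ℕ, ∀ v ∈ T.nodes, v ≠ T.root → d (T.parent v) < d v := by
  refine ⟨fun v => sInf {i | T.parent^[i] v = T.root}, fun v hv hr => ?_⟩
  have hmem : T.parent^[sInf {i | T.parent^[i] v = T.root}] v = T.root :=
    Nat.sInf_mem (s := {i | T.parent^[i] v = T.root}) (T.reaches_root v hv)
  rcases hd : sInf {i | T.parent^[i] v = T.root} with _ | j
  · rw [hd] at hmem
    exact absurd hmem hr
  · rw [hd, Function.iterate_succ_apply] at hmem
    beta_reduce
    rw [hd]
    exact Nat.lt_succ_of_le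
      (Nat.sInf_le (s := {i | T.parent^[i] (T.parent v) = T.root}) hmem)

theorem parent_ne (T : StreettSafraTree S n k) {v : Fin (n * (k + 1))} (hv : v ∈ T.nodes)
    (hr : v ≠ T.root) : T.parent v ≠ v := by
  obtain ⟨d, hd⟩ := T.exists_depth
  intro h
  have := hd v hv hr
  rw [h] at this
  exact this.false

theorem parent_root (T : StreettSafraTree S n k) : T.parent T.root = T.root :=
  T.parent_id _ (Or.inr rfl)

/-- Induction from the root towards the leaves. -/
theorem induction_from_root (T : StreettSafraTree S n k) {P : Fin (n * (k + 1)) → Prop}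
    (root : P T.root) (son : ∀ v ∈ T.nodes, v ≠ T.root → P (T.parent v) → P v) :
    ∀ v ∈ T.nodes, P v := by
  obtain ⟨d, hd⟩ := T.exists_depth
  intro v
  induction v using (measure d).wf.induction with
  | _ v ih =>
    intro hv
    by_cases hr : v = T.root
    · exact hr ▸ root
    · exact son v hv hr (ih _ (hd v hv hr) (T.parent_mem v hv hr))

/-- Induction from the leaves towards the root. -/
theorem induction_from_leaves (T : StreettSafraTree S n k) {P : Fin (n * (k + 1)) → Prop}
    (step : ∀ v ∈ T.nodes, (∀ u ∈ T.nodes, u ≠ T.root → T.parent u = v → P u) → P v) :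
    ∀ v ∈ T.nodes, P v := by
  obtain ⟨d, hd⟩ := T.exists_depth
  let R : Fin (n * (k + 1)) → Fin (n * (k + 1)) → Prop := fun u v => d v < d u
  have : IsTrans _ R := ⟨fun _ _ _ h h' => lt_trans h' h⟩
  have : Std.Irrefl R := ⟨fun _ h => lt_irrefl _ h⟩
  intro v
  induction v using (Finite.wellFounded_of_trans_of_irrefl R).induction with
  | _ v ih =>
    intro hv
    exact step v hv fun u hu hr hp => ih u (hp ▸ hd u hu hr) hu

theorem older_irrefl (T : StreettSafraTree S n k) (v : Fin (n * (k + 1))) : ¬ T.older v v :=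
  fun h => T.older_asymm v v h h

theorem wellFounded_older (T : StreettSafraTree S n k) : WellFounded T.older := by
  have : IsTrans _ T.older := ⟨T.older_trans⟩
  have : Std.Irrefl T.older := ⟨T.older_irrefl⟩
  exact Finite.wellFounded_of_trans_of_irrefl T.older

theorem wellFounded_flip_older (T : StreettSafraTree S n k) : WellFounded (flip T.older) := by
  have : IsTrans _ (flip T.older) := ⟨fun _ _ _ h h' => T.older_trans _ _ _ h' h⟩
  have : Std.Irrefl (flip T.older) := ⟨T.older_irrefl⟩
  exact Finite.wellFounded_of_trans_of_irrefl _

/-- A node having an older sibling has an immediately older one. -/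
theorem exists_immediate_older (T : StreettSafraTree S n k) {v u : Fin (n * (k + 1))}
    (h : T.older u v) :
    ∃ w, T.older w v ∧ ∀ u, T.older u v ↔ u = w ∨ T.older u w := by
  obtain ⟨w, hw, hmin⟩ := T.wellFounded_flip_older.has_min {u | T.older u v} ⟨u, h⟩
  refine ⟨w, hw, fun u => ⟨fun hu => ?_, ?_⟩⟩
  · by_contra! hne
    obtain ⟨hwN, -, hwr, -, -, hwp⟩ := T.older_sib _ _ hw
    obtain ⟨huN, -, hur, -, -, hup⟩ := T.older_sib _ _ hu
    rcases T.older_total u huN w hwN hur hwr hne.1 (hup.trans hwp.symm) with h1 | h1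
    · exact hne.2 h1
    · exact hmin u hu h1
  · rintro (rfl | hu)
    · exact hw
    · exact T.older_trans _ _ _ hu hw

/-- The code of the shape of the tree at `v`: nonroot nodes point to their immediately older
sibling (flag `false`) or, in the absence of older siblings, to their parent (flag `true`).  The
root and the elements outside of the tree point to themselves. -/
def IsPointer (T : StreettSafraTree S n k) (v : Fin (n * (k + 1)))
    (p : Fin (n * (k + 1)) × Bool) : Prop :=
  (v ∉ T.nodes ∧ p = (v, false)) ∨ (v = T.root ∧ p = (v, true)) ∨
  (v ∈ T.nodes ∧ v ≠ T.root ∧ (∀ u, ¬ T.older u v) ∧ p = (T.parent v, true)) ∨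
  (v ∈ T.nodes ∧ v ≠ T.root ∧ ∃ w, T.older w v ∧ (∀ u, T.older u v ↔ u = w ∨ T.older u w) ∧
    p = (w, false))

theorem exists_isPointer (T : StreettSafraTree S n k) (v : Fin (n * (k + 1))) :
    ∃ p, T.IsPointer v p := by
  by_cases hv : v ∈ T.nodes
  · by_cases hr : v = T.root
    · exact ⟨_, Or.inr (Or.inl ⟨hr, rfl⟩)⟩
    · by_cases ho : ∃ u, T.older u v
      · obtain ⟨u, hu⟩ := ho
        obtain ⟨w, hw, hw'⟩ := T.exists_immediate_older hu
        exact ⟨_, Or.inr (Or.inr (Or.inr ⟨hv, hr, w, hw, hw', rfl⟩))⟩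
      · exact ⟨_, Or.inr (Or.inr (Or.inl ⟨hv, hr, not_exists.mp ho, rfl⟩))⟩
  · exact ⟨_, Or.inl ⟨hv, rfl⟩⟩

section Pointer

variable {T T' : StreettSafraTree S n k} {v : Fin (n * (k + 1))} {p : Fin (n * (k + 1)) × Bool}

theorem IsPointer.not_mem_iff (h : T.IsPointer v p) : v ∉ T.nodes ↔ p = (v, false) := by
  rcases h with ⟨hv, rfl⟩ | ⟨rfl, rfl⟩ | ⟨hv, hr, -, rfl⟩ | ⟨hv, hr, w, hw, -, rfl⟩
  · simpa using hv
  · simpa using T.root_mem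
  · simpa using hv
  · simpa [hv] using fun h : w = v => T.older_irrefl v (h ▸ hw)

theorem IsPointer.eq_root_iff (h : T.IsPointer v p) : v = T.root ↔ p = (v, true) := by
  rcases h with ⟨hv, rfl⟩ | ⟨rfl, rfl⟩ | ⟨hv, hr, -, rfl⟩ | ⟨hv, hr, w, hw, -, rfl⟩
  · simpa using fun h : v = T.root => hv (h ▸ T.root_mem)
  · simp
  · simpa [hr] using T.parent_ne hv hr
  · simpa using hr

theorem IsPointer.first (h : T.IsPointer v (p.1, true)) (hr : v ≠ T.root) :
    (∀ u, ¬ T.older u v) ∧ T.parent v = p.1 := by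
  rcases h with ⟨-, h⟩ | ⟨h, -⟩ | ⟨-, -, ho, h⟩ | ⟨-, -, w, -, -, h⟩
  · simp at h
  · exact absurd h hr
  · exact ⟨ho, (congrArg Prod.fst h).symm⟩
  · simp at h

theorem IsPointer.next (h : T.IsPointer v (p.1, false)) (hv : v ∈ T.nodes) :
    T.older p.1 v ∧ ∀ u, T.older u v ↔ u = p.1 ∨ T.older u p.1 := by
  rcases h with ⟨h, -⟩ | ⟨-, h⟩ | ⟨-, -, -, h⟩ | ⟨-, -, w, hw, hw', h⟩
  · exact absurd hv h
  · simp at h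
  · simp at h
  · obtain rfl : p.1 = w := congrArg Prod.fst h
    exact ⟨hw, hw'⟩

variable {f : Fin (n * (k + 1)) → Fin (n * (k + 1)) × Bool}

theorem nodes_eq_of_isPointer (h : ∀ v, T.IsPointer v (f v)) (h' : ∀ v, T'.IsPointer v (f v)) :
    T.nodes = T'.nodes := by
  ext v
  exact not_iff_not.mp ((h v).not_mem_iff.trans (h' v).not_mem_iff.symm)

theorem root_eq_of_isPointer (h : ∀ v, T.IsPointer v (f v)) (h' : ∀ v, T'.IsPointer v (f v)) :
    T.root = T'.root :=
  (h' _).eq_root_iff.mpr ((h _).eq_root_iff.mp rfl)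

theorem parent_older_eq_of_isPointer (h : ∀ v, T.IsPointer v (f v))
    (h' : ∀ v, T'.IsPointer v (f v)) (v : Fin (n * (k + 1))) :
    T.parent v = T'.parent v ∧ ∀ u, T.older u v ↔ T'.older u v := by
  have hN := nodes_eq_of_isPointer h h'
  have hR := root_eq_of_isPointer h h'
  induction v using T.wellFounded_older.induction with
  | _ v ih =>
    by_cases hv : v ∈ T.nodes ∧ v ≠ T.root
    · obtain ⟨hv, hr⟩ := hv
      have hv' := hN ▸ hv
      have hr' := hR ▸ hr
      have h1 := h v
      have h2 := h' v
      rcases hp : f v with ⟨w, _ | _⟩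
      · rw [hp] at h1 h2
        obtain ⟨o1, i1⟩ := IsPointer.next (p := (w, false)) h1 hv
        obtain ⟨o2, i2⟩ := IsPointer.next (p := (w, false)) h2 hv'
        obtain ⟨ihp, iho⟩ := ih w o1
        refine ⟨?_, fun u => ?_⟩
        · rw [← (T.older_sib _ _ o1).2.2.2.2.2, ← (T'.older_sib _ _ o2).2.2.2.2.2, ihp]
        · rw [i1, i2, iho]
      · rw [hp] at h1 h2
        obtain ⟨o1, e1⟩ := IsPointer.first (p := (w, true)) h1 hr
        obtain ⟨o2, e2⟩ := IsPointer.first (p := (w, true)) h2 hr'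
        exact ⟨e1.trans e2.symm, fun u => iff_of_false (o1 u) (o2 u)⟩
    · have hv' : ¬ (v ∈ T'.nodes ∧ v ≠ T'.root) := by rwa [← hN, ← hR]
      refine ⟨?_, fun u => iff_of_false (fun ho => ?_) (fun ho => ?_)⟩
      · rw [T.parent_id v (by tauto), T'.parent_id v (by tauto)]
      · obtain ⟨-, a, -, b, -⟩ := T.older_sib _ _ ho
        exact hv ⟨a, b⟩
      · obtain ⟨-, a, -, b, -⟩ := T'.older_sib _ _ ho
        exact hv' ⟨a, b⟩

end Pointer

/-- Some element accounts for the difference between the annotations of `v` and its parent. -/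
theorem exists_missing (T : StreettSafraTree S n k) (v : Fin (n * (k + 1))) :
    ∃ a : Option (Fin k), v ∈ T.nodes → v ≠ T.root →
      ∀ x, x ∈ T.ann v ↔ x ∈ T.ann (T.parent v) ∧ a ≠ some x := by
  by_cases hv : v ∈ T.nodes ∧ v ≠ T.root
  · obtain ⟨hv, hr⟩ := hv
    by_cases ha : ∃ y, y ∈ T.ann (T.parent v) ∧ y ∉ T.ann v
    · obtain ⟨y, hy, hy'⟩ := ha
      refine ⟨some y, fun _ _ x => ⟨fun hx => ⟨T.ann_sub v hv hr hx, ?_⟩, fun hx => ?_⟩⟩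
      · rintro ⟨⟩
        exact hy' hx
      · by_contra hx'
        exact hx.2 (congrArg some (T.ann_miss v hv hr y x hy hy' hx.1 hx'))
    · push Not at ha
      exact ⟨none, fun _ _ x => ⟨fun hx => ⟨T.ann_sub v hv hr hx, by simp⟩, fun hx => ha x hx.1⟩⟩
  · exact ⟨none, fun h1 h2 => absurd ⟨h1, h2⟩ hv⟩

theorem ann_eq {T T' : StreettSafraTree S n k} (hN : T.nodes = T'.nodes)
    (hR : T.root = T'.root) (hP : T.parent = T'.parent) {a : Fin (n * (k + 1)) → Option (Fin k)}
    (h : ∀ v, v ∈ T.nodes → v ≠ T.root →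
      ∀ x, x ∈ T.ann v ↔ x ∈ T.ann (T.parent v) ∧ a v ≠ some x)
    (h' : ∀ v, v ∈ T'.nodes → v ≠ T'.root →
      ∀ x, x ∈ T'.ann v ↔ x ∈ T'.ann (T'.parent v) ∧ a v ≠ some x) :
    T.ann = T'.ann := by
  have key : ∀ v ∈ T.nodes, T.ann v = T'.ann v := by
    refine T.induction_from_root ?_ fun v hv hr ih => ?_
    · rw [T.ann_root, hR, T'.ann_root]
    · ext x
      rw [h v hv hr, h' v (hN ▸ hv) (hR ▸ hr), ih, hP]
  funext v
  by_cases hv : v ∈ T.nodes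
  · exact key v hv
  · rw [T.ann_empty v hv, T'.ann_empty v (hN ▸ hv)]

theorem exists_colour (T : StreettSafraTree S n k) (v : Fin (n * (k + 1))) :
    ∃ c : Fin 3, (v ∈ T.Eset ↔ c = 0) ∧ (v ∈ T.Fset ↔ c = 1) := by
  by_cases hE : v ∈ T.Eset
  · have hF : v ∉ T.Fset := fun hF =>
      (T.EF_disj ▸ (⟨hE, hF⟩ : v ∈ T.Eset ∩ T.Fset) : v ∈ (∅ : Set _))
    exact ⟨0, by simp [hE, hF]⟩
  · by_cases hF : v ∈ T.Fset
    · exact ⟨1, by simp [hE, hF]⟩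
    · exact ⟨2, by simp [hE, hF]⟩

open Classical in
/-- The nodes without sons. -/
noncomputable def leaves (T : StreettSafraTree S n k) : Finset (Fin (n * (k + 1))) :=
  T.nodes.filter fun v => ¬ ∃ u, u ∈ T.nodes ∧ u ≠ T.root ∧ T.parent u = v

theorem mem_leaves (T : StreettSafraTree S n k) {v : Fin (n * (k + 1))} :
    v ∈ T.leaves ↔ v ∈ T.nodes ∧ ¬ ∃ u, u ∈ T.nodes ∧ u ≠ T.root ∧ T.parent u = v := by
  simp only [leaves, Finset.mem_filter]

theorem iterate_parent_mem (T : StreettSafraTree S n k) {v : Fin (n * (k + 1))}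
    (hv : v ∈ T.nodes) {s : S} (hs : s ∈ T.label v) (i : ℕ) :
    T.parent^[i] v ∈ T.nodes ∧ s ∈ T.label (T.parent^[i] v) := by
  induction i with
  | zero => exact ⟨hv, hs⟩
  | succ i ih =>
    rw [Function.iterate_succ_apply']
    obtain ⟨hw, hsw⟩ := ih
    by_cases hr : T.parent^[i] v = T.root
    · rw [hr] at hw hsw ⊢
      rw [T.parent_root]
      exact ⟨hw, hsw⟩
    · refine ⟨T.parent_mem _ hw hr, ?_⟩
      rw [T.label_union _ (T.parent_mem _ hw hr) ⟨_, hw, hr, rfl⟩]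
      exact ⟨_, hw, hr, rfl, hsw⟩

/-- Nodes whose labels intersect are comparable in the tree. -/
theorem comparable (T : StreettSafraTree S n k) {s : S} {v : Fin (n * (k + 1))}
    (hv : v ∈ T.nodes) (hsv : s ∈ T.label v) :
    ∀ u ∈ T.nodes, s ∈ T.label u → (∃ i, T.parent^[i] u = v) ∨ ∃ i, T.parent^[i] v = u := by
  refine T.induction_from_root ?_ fun u hu hr ih hsu => ?_
  · exact fun _ => Or.inr (T.reaches_root v hv)
  · rcases ih (T.iterate_parent_mem hu hsu 1).2 with ⟨i, hi⟩ | ⟨i, hi⟩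
    · exact Or.inl ⟨i + 1, hi⟩
    · induction i with
      | zero => exact Or.inl ⟨1, hi.symm⟩
      | succ i ihi =>
        obtain ⟨hw, hsw⟩ := T.iterate_parent_mem hv hsv i
        rw [Function.iterate_succ_apply'] at hi
        by_cases hwr : T.parent^[i] v = T.root
        · refine ihi ?_
          rwa [hwr, T.parent_root, ← hwr] at hi
        · refine Or.inr ⟨i, ?_⟩
          by_contra hne
          have := T.label_disj _ hw u hu hwr hr hne hi
          exact (this ▸ (⟨hsw, hsu⟩ : s ∈ T.label (T.parent^[i] v) ∩ T.label u) : s ∈ (∅ : Set S))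

theorem eq_of_iterate_parent_eq_leaf (T : StreettSafraTree S n k) {u v : Fin (n * (k + 1))}
    (hu : u ∈ T.leaves) (hv : v ∈ T.nodes) {s : S} (hs : s ∈ T.label v) {i : ℕ}
    (hi : T.parent^[i] v = u) : v = u := by
  induction i with
  | zero => exact hi
  | succ i ih =>
    rw [Function.iterate_succ_apply'] at hi
    by_cases hr : T.parent^[i] v = T.root
    · refine ih ?_
      rwa [hr, T.parent_root, ← hr] at hi
    · exact absurd ⟨_, (T.iterate_parent_mem hv hs i).1, hr, hi⟩ (T.mem_leaves.mp hu).2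

/-- The labels of distinct leaves are disjoint. -/
theorem leaf_unique (T : StreettSafraTree S n k) {u v : Fin (n * (k + 1))} (hu : u ∈ T.leaves)
    (hv : v ∈ T.leaves) {s : S} (hsu : s ∈ T.label u) (hsv : s ∈ T.label v) : u = v := by
  have hu' := (T.mem_leaves.mp hu).1
  have hv' := (T.mem_leaves.mp hv).1
  rcases T.comparable hv' hsv u hu' hsu with ⟨i, hi⟩ | ⟨i, hi⟩
  · exact T.eq_of_iterate_parent_eq_leaf hv hu' hsu hi
  · exact (T.eq_of_iterate_parent_eq_leaf hu hv' hsv hi).symm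

theorem card_leaves_le [Fintype S] (T : StreettSafraTree S n k) :
    T.leaves.card ≤ Fintype.card S := by
  have h : ∀ v : T.leaves, ∃ s, s ∈ T.label v :=
    fun v => T.label_nonempty v (T.mem_leaves.mp v.2).1
  choose g hg using h
  rw [← Fintype.card_coe]
  refine Fintype.card_le_of_injective g fun u v huv => Subtype.ext ?_
  exact T.leaf_unique u.2 v.2 (hg u) (huv ▸ hg v)

/-- The position of every state among the leaves, whose names are encoded by `e`. -/
theorem exists_position (T : StreettSafraTree S n k) {α : Type} {e : Fin (n * (k + 1)) → α}
    (he : Set.InjOn e T.leaves) (s : S) :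
    ∃ a : Option α, ∀ v ∈ T.leaves, s ∈ T.label v ↔ a = some (e v) := by
  by_cases h : ∃ u ∈ T.leaves, s ∈ T.label u
  · obtain ⟨u, hu, hsu⟩ := h
    refine ⟨some (e u), fun v hv => ⟨fun hsv => ?_, fun huv => ?_⟩⟩
    · rw [T.leaf_unique hu hv hsu hsv]
    · rwa [← he hu hv (Option.some_injective _ huv)]
  · push Not at h
    exact ⟨none, fun v hv => by simpa using h v hv⟩

theorem label_eq {T T' : StreettSafraTree S n k} (hN : T.nodes = T'.nodes)
    (hR : T.root = T'.root) (hP : T.parent = T'.parent)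
    (h : ∀ v ∈ T.leaves, T.label v = T'.label v) : T.label = T'.label := by
  have key : ∀ v ∈ T.nodes, T.label v = T'.label v := by
    refine T.induction_from_leaves fun v hv ih => ?_
    by_cases hs : ∃ u, u ∈ T.nodes ∧ u ≠ T.root ∧ T.parent u = v
    · have hs' : ∃ u, u ∈ T'.nodes ∧ u ≠ T'.root ∧ T'.parent u = v := by rwa [← hN, ← hR, ← hP]
      rw [T.label_union v hv hs, T'.label_union v (hN ▸ hv) hs', ← hN, ← hR, ← hP]
      ext s
      constructor
      · rintro ⟨u, hu, hr, hp, hsu⟩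
        exact ⟨u, hu, hr, hp, ih u hu hr hp ▸ hsu⟩
      · rintro ⟨u, hu, hr, hp, hsu⟩
        exact ⟨u, hu, hr, hp, (ih u hu hr hp).symm ▸ hsu⟩
    · exact h v (T.mem_leaves.mpr ⟨hv, hs⟩)
  funext v
  by_cases hv : v ∈ T.nodes
  · exact key v hv
  · rw [T.label_empty v hv, T'.label_empty v (hN ▸ hv)]

theorem leaves_eq {T T' : StreettSafraTree S n k} (hN : T.nodes = T'.nodes)
    (hR : T.root = T'.root) (hP : T.parent = T'.parent) : T.leaves = T'.leaves := by
  ext v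
  rw [T.mem_leaves, T'.mem_leaves, hN, hR, hP]

theorem exists_injOn_fin {α : Type} (hn : 1 ≤ n) (L : Finset α) :
    ∃ e : α → Fin n, L.card ≤ n → Set.InjOn e L := by
  have : NeZero n := ⟨by omega⟩
  by_cases hL : L.card ≤ n
  · classical
    refine ⟨fun v => if h : v ∈ L then Fin.castLE hL (L.equivFin ⟨v, h⟩) else 0,
      fun _ u hu v hv huv => ?_⟩
    have hu' : u ∈ L := hu
    have hv' : v ∈ L := hv
    simpa [hu', hv'] using huv
  · exact ⟨fun _ => 0, fun h => absurd h hL⟩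

/-- Streett Safra trees are encoded by a pointer, a missing element and a colour for every element
of `V`, together with the positions of the states. -/
theorem exists_injective_code [Fintype S] (hn : 1 ≤ n) (hcard : Fintype.card S = n) :
    ∃ c : StreettSafraTree S n k →
      (Fin (n * (k + 1)) → (Fin (n * (k + 1)) × Bool) × Option (Fin k) × Fin 3) ×
        (S → Option (Fin n)), Function.Injective c := by
  choose e he using fun L : Finset (Fin (n * (k + 1))) => exists_injOn_fin (n := n) hn L
  choose p hp using fun T : StreettSafraTree S n k => T.exists_isPointer
  choose a ha using fun T : StreettSafraTree S n k => T.exists_missing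
  choose q hqE hqF using fun T : StreettSafraTree S n k => T.exists_colour
  choose f hf using fun T : StreettSafraTree S n k =>
    T.exists_position (he T.leaves (hcard ▸ T.card_leaves_le))
  refine ⟨fun T => (fun v => (p T v, a T v, q T v), f T), fun T T' hTT' => ?_⟩
  simp only [Prod.mk.injEq, funext_iff] at hTT'
  obtain ⟨hv, hs⟩ := hTT'
  have hp' : ∀ v, T'.IsPointer v (p T v) := fun v => (hv v).1 ▸ hp T' v
  have hN := nodes_eq_of_isPointer (hp T) hp'
  have hR := root_eq_of_isPointer (hp T) hp'
  have hPO := parent_older_eq_of_isPointer (hp T) hp'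
  have hP : T.parent = T'.parent := funext fun v => (hPO v).1
  refine ext_fields hN hR hP ?_ ?_ ?_ ?_ ?_
  · funext u v
    exact propext ((hPO v).2 u)
  · refine label_eq hN hR hP fun v hvL => ?_
    have hL := leaves_eq hN hR hP
    ext s
    rw [hf T s v hvL, hf T' s v (hL ▸ hvL), hs, hL]
  · exact ann_eq hN hR hP (ha T) fun v => (hv v).2.1 ▸ ha T' v
  · ext v
    rw [hqE, hqE, (hv v).2.2]
  · ext v
    rw [hqF, hqF, (hv v).2.2]

end StreettSafraTree

/-- For every finite set `S` with `|S| = n ≥ 1` and every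
`k ≥ 1`, the number of Streett Safra trees over `S` with index `k` is at most
`12^{n(k+1)}·n^n·(k+1)^{n(k+1)}·(n(k+1))^{n(k+1)}`. -/
theorem streettSafraTree_count (S : Type) [Fintype S] (n k : ℕ) (hn : 1 ≤ n)
    (hk : 1 ≤ k) (hcard : Fintype.card S = n) :
    Nat.card (StreettSafraTree S n k) ≤
      12 ^ (n * (k + 1)) * n ^ n * (k + 1) ^ (n * (k + 1)) *
        (n * (k + 1)) ^ (n * (k + 1)) := by
  obtain ⟨c, hc⟩ := StreettSafraTree.exists_injective_code (k := k) hn hcard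
  have h1 : (n + 1) ^ n ≤ 2 ^ (n * (k + 1)) * n ^ n :=
    calc (n + 1) ^ n ≤ (2 * n) ^ n := Nat.pow_le_pow_left (by omega) n
      _ = 2 ^ n * n ^ n := mul_pow ..
      _ ≤ 2 ^ (n * (k + 1)) * n ^ n := by
        gcongr
        · norm_num
        · exact Nat.le_mul_of_pos_right n k.succ_pos
  calc Nat.card (StreettSafraTree S n k) ≤ _ := Nat.card_le_card_of_injective c hc
    _ = (n * (k + 1) * 2 * ((k + 1) * 3)) ^ (n * (k + 1)) * (n + 1) ^ n := by
      classical
      simp [Nat.card_eq_fintype_card, hcard]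
    _ ≤ (n * (k + 1) * 2 * ((k + 1) * 3)) ^ (n * (k + 1)) * (2 ^ (n * (k + 1)) * n ^ n) := by
      gcongr
    _ = 12 ^ (n * (k + 1)) * n ^ n * (k + 1) ^ (n * (k + 1)) *
        (n * (k + 1)) ^ (n * (k + 1)) := by
      rw [show (12 : ℕ) = 2 * 3 * 2 by norm_num]
      simp only [mul_pow]
      ring
end
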